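/- arXiv:1002.4123 — 4 statements merged into one kernel-verified Lean document; each statement's English description precedes it below -/
import Mathlib

section
/- Let x ∈ L²(t0,T;ℝⁿ) solve the DAE with input f ∈ L²(t0,T;ℝᵐ) (so Fx absolutely continuous, (Fx)' = Cx + f a.e., Fx(t0) = 0), let ℓ ∈ ℝⁿ, and let w ∈ L²(t0,T;ℝᵐ) be such that F'w is absolutely continuous with square-integrable derivative and F'w(T) = F'ℓ. Then ⟨ℓ, Fx(T)⟩ = ∫_{t0}^T [ ⟨f(t), w(t)⟩ + ⟨(F'w)'(t) + C'(t)w(t), x(t)⟩ ] dt. (Duality identity (eq:i1) in the proof of Theorem 1.) -/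
open Matrix Set
open scoped ENNReal

noncomputable section

/-- `x : ℝ → E` is (a representative of an element of) `L²(t0,T;E)`. -/
def L2On {E : Type*} [NormedAddCommGroup E] (t0 T : ℝ) (x : ℝ → E) : Prop :=
  MeasureTheory.AEStronglyMeasurable x (MeasureTheory.volume.restrict (Icc t0 T)) ∧
    MeasureTheory.IntegrableOn (fun t => ‖x t‖ ^ 2) (Icc t0 T) MeasureTheory.volume

/-- An admissible noise: a jointly measurable stochastic process `η` on some probability
space, with values in `ℝᵖ`, zero mean for a.e. `t ∈ [t0,T]`, and
`∫_{t0}^T ⟨R(t)η(t,ω), η(t,ω)⟩ dt ≤ 1` for almost every `ω`. -/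
structure Noise (t0 T : ℝ) (p : ℕ) (R : ℝ → Matrix (Fin p) (Fin p) ℝ) where
  Omega : Type
  [instMeas : MeasurableSpace Omega]
  P : MeasureTheory.Measure Omega
  [isProb : MeasureTheory.IsProbabilityMeasure P]
  η : ℝ → Omega → (Fin p → ℝ)
  jointMeas : Measurable (Function.uncurry η)
  zeroMean : ∀ᵐ t ∂(MeasureTheory.volume.restrict (Icc t0 T)), (∫ ω, η t ω ∂P) = 0
  bound : ∀ᵐ ω ∂P, (∫ t in t0..T, ((R t) *ᵥ (η t ω)) ⬝ᵥ (η t ω)) ≤ 1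

attribute [instance] Noise.instMeas Noise.isProb

open MeasureTheory

/-- `x` solves the DAE `(Fx)' = C(t)x + f`, `Fx(t0) = 0`, in the integral sense:
`Fx(t) = ∫_{t0}^t (C(s)x(s) + f(s)) ds` for all `t ∈ [t0,T]`, with `x ∈ L²`. -/
def SolvesDAE {m n : ℕ} (t0 T : ℝ) (F : Matrix (Fin m) (Fin n) ℝ)
    (C : ℝ → Matrix (Fin m) (Fin n) ℝ) (f : ℝ → (Fin m → ℝ)) (x : ℝ → (Fin n → ℝ)) : Prop :=
  L2On t0 T x ∧ ∀ t ∈ Icc t0 T, F *ᵥ x t = ∫ s in t0..t, ((C s) *ᵥ x s + f s)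

/-- The ellipsoid `G` of admissible inputs: `f ∈ L²` with `∫_{t0}^T ⟨Q(t)f(t), f(t)⟩ dt ≤ 1`. -/
def MemG {m : ℕ} (t0 T : ℝ) (Q : ℝ → Matrix (Fin m) (Fin m) ℝ) (f : ℝ → (Fin m → ℝ)) : Prop :=
  L2On t0 T f ∧ (∫ t in t0..T, ((Q t) *ᵥ f t) ⬝ᵥ f t) ≤ 1

/-- `z` solves the adjoint DAE with data `(u,ℓ)`:  `F'z` is absolutely continuous,
`(F'z)' = −C'(t)z + H'(t)u` a.e., `F'z(T) = F'ℓ`; in the equivalent integral form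
`F'z(t) = F'ℓ − ∫_t^T (−C'(s)z(s) + H'(s)u(s)) ds` for all `t ∈ [t0,T]`, with `z ∈ L²`. -/
def SolvesAdjoint {m n p : ℕ} (t0 T : ℝ) (F : Matrix (Fin m) (Fin n) ℝ)
    (C : ℝ → Matrix (Fin m) (Fin n) ℝ) (H : ℝ → Matrix (Fin p) (Fin n) ℝ)
    (u : ℝ → (Fin p → ℝ)) (ℓ : Fin m → ℝ) (z : ℝ → (Fin m → ℝ)) : Prop :=
  L2On t0 T z ∧ ∀ t ∈ Icc t0 T,
    Fᵀ *ᵥ z t = Fᵀ *ᵥ ℓ - ∫ s in t..T, (-((C s)ᵀ *ᵥ z s) + (H s)ᵀ *ᵥ u s)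

/-- The mean-squared estimation error of the estimation `u` in the direction `ℓ`,
for a given input `f`, solution `x` and noise `η`:
`E[⟨ℓ, Fx(T)⟩ − ∫_{t0}^T ⟨u(t), H(t)x(t) + η(t)⟩ dt]²`. -/
def errSq {m n p : ℕ} (t0 T : ℝ) (F : Matrix (Fin m) (Fin n) ℝ)
    (H : ℝ → Matrix (Fin p) (Fin n) ℝ) {R : ℝ → Matrix (Fin p) (Fin p) ℝ}
    (ℓ : Fin m → ℝ) (u : ℝ → (Fin p → ℝ)) (x : ℝ → (Fin n → ℝ))
    (N : Noise t0 T p R) : ℝ :=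
  ∫ ω, (ℓ ⬝ᵥ (F *ᵥ x T) - ∫ t in t0..T, (u t) ⬝ᵥ ((H t) *ᵥ x t + N.η t ω)) ^ 2 ∂N.P

/-- The worst-case mean-squared estimation error `σ(T,u,ℓ)` (valued in `ℝ≥0∞`,
so that finiteness can be expressed): the supremum of the mean-squared error over all
`f ∈ G`, all solutions `x` of the DAE with input `f`, and all admissible noises. -/
def sigmaErr {m n p : ℕ} (t0 T : ℝ) (F : Matrix (Fin m) (Fin n) ℝ)
    (C : ℝ → Matrix (Fin m) (Fin n) ℝ) (H : ℝ → Matrix (Fin p) (Fin n) ℝ)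
    (Q : ℝ → Matrix (Fin m) (Fin m) ℝ) (R : ℝ → Matrix (Fin p) (Fin p) ℝ)
    (u : ℝ → (Fin p → ℝ)) (ℓ : Fin m → ℝ) : ℝ≥0∞ :=
  ⨆ (f : ℝ → (Fin m → ℝ)) (x : ℝ → (Fin n → ℝ)) (N : Noise t0 T p R)
    (_ : MemG t0 T Q f) (_ : SolvesDAE t0 T F C f x),
      ENNReal.ofReal (errSq t0 T F H ℓ u x N)

/-- The minimax error `σ̂(T,ℓ) = inf_{u ∈ L²} σ(T,u,ℓ)`. -/
def sigmaHat {m n p : ℕ} (t0 T : ℝ) (F : Matrix (Fin m) (Fin n) ℝ)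
    (C : ℝ → Matrix (Fin m) (Fin n) ℝ) (H : ℝ → Matrix (Fin p) (Fin n) ℝ)
    (Q : ℝ → Matrix (Fin m) (Fin m) ℝ) (R : ℝ → Matrix (Fin p) (Fin p) ℝ)
    (ℓ : Fin m → ℝ) : ℝ≥0∞ :=
  ⨅ (u : ℝ → (Fin p → ℝ)) (_ : L2On t0 T u), sigmaErr t0 T F C H Q R u ℓ

/-- Every matrix over a field has a generalized inverse. -/
theorem Matrix.exists_mul_mul_self_eq {K m n : Type*} [Field K] [Fintype m] [DecidableEq m]
    [Fintype n] [DecidableEq n] (F : Matrix m n K) :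
    ∃ P : Matrix n m K, F * P * F = F := by
  obtain ⟨s, hs⟩ := F.toLin'.rangeRestrict.exists_rightInverse_of_surjective
    F.toLin'.range_rangeRestrict
  obtain ⟨p, hp⟩ := s.exists_extend
  refine ⟨LinearMap.toMatrix' p, Matrix.toLin'.injective (LinearMap.ext fun v => ?_)⟩
  have hpv : p (F.toLin' v) = s (F.toLin'.rangeRestrict v) :=
    LinearMap.congr_fun hp (F.toLin'.rangeRestrict v)
  have hsv := congrArg Subtype.val (LinearMap.congr_fun hs (F.toLin'.rangeRestrict v))
  rw [Matrix.toLin'_mul, Matrix.toLin'_mul, Matrix.toLin'_toMatrix', LinearMap.comp_apply,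
    LinearMap.comp_apply, hpv]
  exact hsv

/-- If a continuous linear map annihilates all the integrals of `h` from the left endpoint, then it
annihilates `h` almost everywhere. -/
theorem ContinuousLinearMap.ae_eq_zero_of_integral_eq_zero {E G : Type*}
    [NormedAddCommGroup E] [NormedSpace ℝ E] [CompleteSpace E]
    [NormedAddCommGroup G] [NormedSpace ℝ G]
    (L : E →L[ℝ] G) {a b : ℝ} (hab : a ≤ b) {h : ℝ → E}
    (hh : IntervalIntegrable h volume a b)
    (h0 : ∀ t ∈ Icc a b, L (∫ s in a..t, h s) = 0) :
    ∀ᵐ t, t ∈ Ioc a b → L (h t) = 0 := by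
  filter_upwards [hh.ae_hasDerivAt_integral, volume.ae_ne b] with t ht htb hmem
  have hd := L.hasFDerivAt.comp_hasDerivAt t
    (ht (uIcc_of_le hab ▸ Ioc_subset_Icc_self hmem) a left_mem_uIcc)
  have hz : (L ∘ fun x => ∫ s in a..x, h s) =ᶠ[nhds t] fun _ => 0 := by
    filter_upwards [Ioo_mem_nhds hmem.1 (hmem.2.lt_of_ne htb)] with u hu
    exact h0 u (Ioo_subset_Icc_self hu)
  exact hd.unique ((hasDerivAt_const t (0 : G)).congr_of_eventuallyEq hz)

/-- If all the integrals of `h` from the left endpoint lie in the range of `A`, then `h` lies in the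
range of `A` almost everywhere; here membership is expressed by a generalized inverse of `A`. -/
theorem Matrix.ae_mulVec_mulVec_eq_of_integral_mem_range {m n : Type*} [Fintype m] [Fintype n]
    {A : Matrix m n ℝ} {B : Matrix n m ℝ} (hAB : A * B * A = A) {a b : ℝ} (hab : a ≤ b)
    {h : ℝ → m → ℝ} (hh : IntervalIntegrable h volume a b)
    (hr : ∀ t ∈ Icc a b, ∃ v, A *ᵥ v = ∫ s in a..t, h s) :
    ∀ᵐ t, t ∈ Ioc a b → A *ᵥ B *ᵥ h t = h t := by
  have hL := ((A * B).mulVecLin - LinearMap.id).toContinuousLinearMap.ae_eq_zero_of_integral_eq_zero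
    hab hh fun t ht => by
      obtain ⟨v, hv⟩ := hr t ht
      rw [← hv]
      change (A * B) *ᵥ A *ᵥ v - A *ᵥ v = 0
      rw [Matrix.mulVec_mulVec, hAB, sub_self]
  filter_upwards [hL] with t ht hmem
  rw [Matrix.mulVec_mulVec]
  exact sub_eq_zero.1 (ht hmem)

/-- Integration by parts for two real functions given as indefinite integrals. -/
theorem intervalIntegral.integral_mul_add_integral_mul {h g : ℝ → ℝ} {a b c : ℝ}
    (hh : IntervalIntegrable h volume a b) (hg : IntervalIntegrable g volume a b) :
    IntervalIntegrable
        (fun t => h t * (c + ∫ s in a..t, g s) + (∫ s in a..t, h s) * g t) volume a b ∧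
      ∫ t in a..b, (h t * (c + ∫ s in a..t, g s) + (∫ s in a..t, h s) * g t) =
        (∫ s in a..b, h s) * (c + ∫ s in a..b, g s) := by
  have hH := hh.absolutelyContinuousOnInterval_intervalIntegral left_mem_uIcc
  have hG : AbsolutelyContinuousOnInterval (fun t => c + ∫ s in a..t, g s) a b :=
    (LipschitzWith.const c).lipschitzOnWith.absolutelyContinuousOnInterval.fun_add
      (hg.absolutelyContinuousOnInterval_intervalIntegral left_mem_uIcc)
  refine ⟨(hh.mul_continuousOn hG.continuousOn).add (hg.continuousOn_mul hH.continuousOn), ?_⟩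
  have key := hH.integral_deriv_mul_eq_sub hG
  simp only [intervalIntegral.integral_same, zero_mul, sub_zero] at key
  rw [← key]
  refine intervalIntegral.integral_congr_ae ?_
  filter_upwards [hh.ae_hasDerivAt_integral, hg.ae_hasDerivAt_integral] with t h1 h2 ht
  have ht' := uIoc_subset_uIcc ht
  rw [(h1 ht' a left_mem_uIcc).deriv, ((h2 ht' a left_mem_uIcc).const_add c).deriv]

theorem intervalIntegral.eval_integral {ι : Type*} [Fintype ι] {h : ℝ → ι → ℝ} {a b : ℝ}
    (hh : IntervalIntegrable h volume a b) (i : ι) :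
    (∫ s in a..b, h s) i = ∫ s in a..b, h s i :=
  ((ContinuousLinearMap.proj (R := ℝ) (φ := fun _ : ι => ℝ) i).intervalIntegral_comp_comm hh).symm

theorem IntervalIntegrable.eval {ι : Type*} [Fintype ι] {h : ℝ → ι → ℝ} {a b : ℝ}
    (hh : IntervalIntegrable h volume a b) (i : ι) :
    IntervalIntegrable (fun s => h s i) volume a b :=
  ⟨Integrable.eval hh.1 i, Integrable.eval hh.2 i⟩

/-- Integration by parts for the dot product of two vector functions given as indefinite
integrals. -/
theorem intervalIntegral.integral_dotProduct_add_integral_dotProduct {ι : Type*} [Fintype ι]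
    {h g : ℝ → ι → ℝ} {a b : ℝ} (c : ι → ℝ)
    (hh : IntervalIntegrable h volume a b) (hg : IntervalIntegrable g volume a b) :
    ∫ t in a..b, (h t ⬝ᵥ (c + ∫ s in a..t, g s) + (∫ s in a..t, h s) ⬝ᵥ g t) =
      (∫ s in a..b, h s) ⬝ᵥ (c + ∫ s in a..b, g s) := by
  have parts (i : ι) :=
    intervalIntegral.integral_mul_add_integral_mul (c := c i) (hh.eval i) (hg.eval i)
  have hsub {t : ℝ} (ht : t ∈ uIcc a b) : uIcc a t ⊆ uIcc a b := uIcc_subset_uIcc_left ht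
  calc
    _ = ∫ t in a..b, ∑ i, (h t i * (c i + ∫ s in a..t, g s i) + (∫ s in a..t, h s i) * g t i) := by
      refine intervalIntegral.integral_congr fun t ht => ?_
      simp only [dotProduct, Pi.add_apply, ← Finset.sum_add_distrib,
        intervalIntegral.eval_integral (hh.mono_set (hsub ht)),
        intervalIntegral.eval_integral (hg.mono_set (hsub ht))]
    _ = _ := by
      rw [intervalIntegral.integral_finsetSum fun i _ => (parts i).1]
      simp only [dotProduct, Pi.add_apply, intervalIntegral.eval_integral hh,
        intervalIntegral.eval_integral hg, (parts _).2]

theorem L2On.integrableOn {E : Type*} [NormedAddCommGroup E] {t0 T : ℝ} {x : ℝ → E}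
    (hx : L2On t0 T x) : IntegrableOn x (Icc t0 T) :=
  ((memLp_two_iff_integrable_sq_norm hx.1).2 hx.2).integrable one_le_two

theorem MeasureTheory.IntegrableOn.continuousOn_mulVec {m n : Type*} [Fintype m] [Fintype n]
    {K : Set ℝ} (hK : IsCompact K) {C : ℝ → Matrix m n ℝ} (hC : ContinuousOn C K)
    {x : ℝ → n → ℝ} (hx : IntegrableOn x K) : IntegrableOn (fun t => C t *ᵥ x t) K :=
  Integrable.of_eval fun i => integrable_finsetSum _ fun j _ =>
    IntegrableOn.continuousOn_mul
      ((continuous_apply_apply i j).comp_continuousOn hC) (Integrable.eval hx j) hK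

/-- duality identity (eq:i1) in the proof of Theorem 1.
If `x` solves the DAE with input `f`, `w ∈ L²` is such that `F'w` is absolutely
continuous with square-integrable derivative `g` (i.e. `F'w(t) = F'w(t0) + ∫_{t0}^t g`)
and `F'w(T) = F'ℓ`, then
`⟨ℓ, Fx(T)⟩ = ∫_{t0}^T [⟨f(t), w(t)⟩ + ⟨(F'w)'(t) + C'(t)w(t), x(t)⟩] dt`. -/
theorem duality_identity
    {m n : ℕ} (t0 T : ℝ) (hT : t0 < T)
    (F : Matrix (Fin m) (Fin n) ℝ)
    (C : ℝ → Matrix (Fin m) (Fin n) ℝ) (hC : ContinuousOn C (Icc t0 T))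
    (f : ℝ → (Fin m → ℝ)) (hf : L2On t0 T f)
    (x : ℝ → (Fin n → ℝ)) (hx : SolvesDAE t0 T F C f x)
    (ℓ : Fin m → ℝ)
    (w : ℝ → (Fin m → ℝ)) (hw : L2On t0 T w)
    (g : ℝ → (Fin n → ℝ)) (hg : L2On t0 T g)
    (hwAC : ∀ t ∈ Icc t0 T, Fᵀ *ᵥ w t = Fᵀ *ᵥ w t0 + ∫ s in t0..t, g s)
    (hwT : Fᵀ *ᵥ w T = Fᵀ *ᵥ ℓ) :
    ℓ ⬝ᵥ (F *ᵥ x T) =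
      ∫ t in t0..T, ((f t) ⬝ᵥ w t + (g t + (C t)ᵀ *ᵥ w t) ⬝ᵥ x t) := by
  obtain ⟨P, hP⟩ := F.exists_mul_mul_self_eq
  obtain ⟨hx2, hxF⟩ := hx
  have hab := hT.le
  set h : ℝ → Fin m → ℝ := fun s => C s *ᵥ x s + f s with h_def
  have hh : IntervalIntegrable h volume t0 T :=
    (intervalIntegrable_iff_integrableOn_Icc_of_le hab).2
      ((hx2.integrableOn.continuousOn_mulVec isCompact_Icc hC).add hf.integrableOn)
  have hgi : IntervalIntegrable g volume t0 T :=
    (intervalIntegrable_iff_integrableOn_Icc_of_le hab).2 hg.integrableOn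
  have hPT : Fᵀ * Pᵀ * Fᵀ = Fᵀ := by
    rw [← Matrix.transpose_mul, ← Matrix.transpose_mul, ← Matrix.mul_assoc, hP]
  -- `h` takes values in the range of `F`, and `g` in that of `Fᵀ`
  have h_range : ∀ᵐ t, t ∈ Ioc t0 T → F *ᵥ P *ᵥ h t = h t :=
    Matrix.ae_mulVec_mulVec_eq_of_integral_mem_range hP hab hh fun t ht => ⟨x t, hxF t ht⟩
  have g_range : ∀ᵐ t, t ∈ Ioc t0 T → Fᵀ *ᵥ Pᵀ *ᵥ g t = g t :=
    Matrix.ae_mulVec_mulVec_eq_of_integral_mem_range hPT hab hgi fun t ht =>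
      ⟨w t - w t0, by rw [Matrix.mulVec_sub, hwAC t ht, add_sub_cancel_left]⟩
  have hPh : IntervalIntegrable (fun s => P *ᵥ h s) volume t0 T :=
    ⟨P.mulVecLin.toContinuousLinearMap.integrable_comp hh.1,
      P.mulVecLin.toContinuousLinearMap.integrable_comp hh.2⟩
  have int_Ph : ∀ t ∈ Icc t0 T, ∫ s in t0..t, P *ᵥ h s = P *ᵥ F *ᵥ x t := fun t ht => by
    rw [hxF t ht]
    exact P.mulVecLin.toContinuousLinearMap.intervalIntegral_comp_comm
      (hh.mono_set (uIcc_subset_uIcc_left (uIcc_of_le hab ▸ ht)))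
  have parts := intervalIntegral.integral_dotProduct_add_integral_dotProduct
    (Fᵀ *ᵥ w t0) hPh hgi
  have hTmem : T ∈ Icc t0 T := right_mem_Icc.2 hab
  -- the adjunction `⟨F u, v⟩ = ⟨u, Fᵀ v⟩`
  have adj {k l : ℕ} (A : Matrix (Fin k) (Fin l) ℝ) (u : Fin l → ℝ) (v : Fin k → ℝ) :
      u ⬝ᵥ (Aᵀ *ᵥ v) = (A *ᵥ u) ⬝ᵥ v := by
    rw [Matrix.mulVec_transpose, dotProduct_comm, ← Matrix.dotProduct_mulVec, dotProduct_comm]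
  calc
    _ = (P *ᵥ F *ᵥ x T) ⬝ᵥ (Fᵀ *ᵥ w T) := by
      rw [hwT, adj, Matrix.mulVec_mulVec, Matrix.mulVec_mulVec, hP, dotProduct_comm]
    _ = _ := by
      rw [← int_Ph T hTmem, hwAC T hTmem, ← parts]
      refine intervalIntegral.integral_congr_ae ?_
      filter_upwards [h_range, g_range] with t ht1 ht2 ht
      rw [uIoc_of_le hab] at ht
      have ht' := Ioc_subset_Icc_self ht
      rw [← hwAC t ht', int_Ph t ht', adj, ht1 ht, ← adj P, ← adj F, ht2 ht, h_def]
      simp only [add_dotProduct]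
      rw [dotProduct_comm (_ᵀ *ᵥ _), adj, dotProduct_comm (x t)]
      ring
end
end

section
/- Let ℓ ∈ 𝓛(T) and ε > 0. Then the Euler–Lagrange system: (F'z)'(t) = −C'(t)z(t) + H'(t)û(t) + p(t) a.e., (Fp)'(t) = C(t)p(t) + ε Q(t)⁻¹ z(t) a.e., û(t) = (1/ε) R(t)H(t)p(t), with boundary conditions Fp(t0) = 0 and F'z(T) + F⁺Fp(T) = F'ℓ (where p ∈ L²(t0,T;ℝⁿ) with Fp absolutely continuous and z ∈ L²(t0,T;ℝᵐ) with F'z absolutely continuous), has exactly one solution pair (p̂(ε), ẑ(ε)). (Proposition 1 (Tikhonov regularization), existence and uniqueness part.) -/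
open Matrix Set
open scoped ENNReal

noncomputable section

open MeasureTheory

open Topology Filter

/-- The four Penrose equations: `Fp` is the Moore–Penrose pseudoinverse of `F`. -/
def IsMoorePenrose {m n : ℕ} (F : Matrix (Fin m) (Fin n) ℝ)
    (Fp : Matrix (Fin n) (Fin m) ℝ) : Prop :=
  F * Fp * F = F ∧ Fp * F * Fp = Fp ∧ (F * Fp)ᵀ = F * Fp ∧ (Fp * F)ᵀ = Fp * F

/-- `(p, z)` solves the Euler–Lagrange system
`(F'z)' = −C'z + H'û + p`, `(Fp)' = Cp + εQ⁻¹z`, `û = (1/ε)RHp`,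
`Fp(t0) = 0`, `F'z(T) + F⁺Fp(T) = F'ℓ` (in the equivalent integral form, with
`p, z ∈ L²`, `Fp` and `F'z` absolutely continuous). -/
def SolvesEL {m n p : ℕ} (t0 T : ℝ) (F : Matrix (Fin m) (Fin n) ℝ)
    (Fplus : Matrix (Fin n) (Fin m) ℝ)
    (C : ℝ → Matrix (Fin m) (Fin n) ℝ) (H : ℝ → Matrix (Fin p) (Fin n) ℝ)
    (Q : ℝ → Matrix (Fin m) (Fin m) ℝ) (R : ℝ → Matrix (Fin p) (Fin p) ℝ)
    (ε : ℝ) (ℓ : Fin m → ℝ) (pe : ℝ → (Fin n → ℝ)) (z : ℝ → (Fin m → ℝ)) : Prop :=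
  L2On t0 T pe ∧ L2On t0 T z ∧
  (∀ t ∈ Icc t0 T,
    F *ᵥ pe t = ∫ s in t0..t, ((C s) *ᵥ pe s + ε • ((Q s)⁻¹ *ᵥ z s))) ∧
  (∀ t ∈ Icc t0 T,
    Fᵀ *ᵥ z t = (Fᵀ *ᵥ ℓ - Fplus *ᵥ (F *ᵥ pe T)) -
      ∫ s in t..T,
        (-((C s)ᵀ *ᵥ z s) + (H s)ᵀ *ᵥ ((1 / ε) • ((R s) *ᵥ ((H s) *ᵥ pe s))) + pe s))

section Abstract

variable {X Y E G : Type*}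
  [NormedAddCommGroup X] [InnerProductSpace ℝ X] [CompleteSpace X]
  [NormedAddCommGroup Y] [InnerProductSpace ℝ Y] [CompleteSpace Y]
  [NormedAddCommGroup E] [InnerProductSpace ℝ E] [CompleteSpace E]
  [NormedAddCommGroup G] [InnerProductSpace ℝ G] [CompleteSpace G]

open ContinuousLinearMap in
/-- A bounded operator with coercive quadratic form is surjective. -/
theorem surjective_of_inner_coercive (W : Y →L[ℝ] Y)
    (hW : ∃ c > 0, ∀ y, c * ‖y‖ ^ 2 ≤ inner ℝ y (W y)) : Function.Surjective W := by
  obtain ⟨c, hc, hcW⟩ := hW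
  have hco : IsCoercive ((innerSL ℝ).comp W) :=
    ⟨c, hc, fun u => by
      have := hcW u
      simp only [coe_comp, Function.comp_apply, innerSL_apply_apply]
      rw [real_inner_comm]; nlinarith⟩
  intro y
  obtain ⟨v, hv⟩ := hco.continuousLinearEquivOfBilin.surjective y
  refine ⟨v, ?_⟩
  refine ext_inner_right ℝ fun w => ?_
  rw [← hv, hco.continuousLinearEquivOfBilin_apply]
  simp

/-- Existence for the abstract Euler–Lagrange system, by the Lax–Milgram theorem on the graph of the
constraint `F x = J' (C x + W y)`. -/
theorem abstractEL_exists (F C : X →L[ℝ] Y) (J : X →L[ℝ] X) (J' : Y →L[ℝ] Y)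
    (K : X →L[ℝ] E) (K' : Y →L[ℝ] G) (f : E →L[ℝ] G) (fp : G →L[ℝ] E)
    (S : X →L[ℝ] X) (W : Y →L[ℝ] Y)
    (hFJ : ∀ x, F (J x) = J' (F x)) (hFK : ∀ x, K' (F x) = f (K x))
    (hproj : ∀ y, f.adjoint (fp.adjoint (fp y)) = fp y)
    (hS : ∀ x, 0 ≤ inner ℝ (S x) x)
    (hW : ∃ c > 0, ∀ y, c * ‖y‖ ^ 2 ≤ inner ℝ y (W y)) (l : G) :
    ∃ x y, F x = J' (C x + W y) ∧
      F.adjoint y = K.adjoint (f.adjoint l - fp (K' (C x + W y))) +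
        J.adjoint (C.adjoint y - S x - x) := by
  have hsurj := surjective_of_inner_coercive W hW
  obtain ⟨c, hc, hcW⟩ := hW
  let p1 : WithLp 2 (X × Y) →L[ℝ] X := WithLp.fstL 2 ℝ X Y
  let p2 : WithLp 2 (X × Y) →L[ℝ] Y := WithLp.sndL 2 ℝ X Y
  let V : Submodule ℝ (WithLp 2 (X × Y)) := (F ∘L p1 - J' ∘L (C ∘L p1 + W ∘L p2)).ker
  have hV : IsClosed (V : Set (WithLp 2 (X × Y))) := ContinuousLinearMap.isClosed_ker _
  have : CompleteSpace V := hV.completeSpace_coe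
  let q1 : V →L[ℝ] X := p1 ∘L V.subtypeL
  let q2 : V →L[ℝ] Y := p2 ∘L V.subtypeL
  let k : V →L[ℝ] G := K' ∘L (C ∘L q1 + W ∘L q2)
  let B : V →L[ℝ] V →L[ℝ] ℝ :=
    (innerSL ℝ).bilinearComp q2 (W ∘L q2) + (innerSL ℝ).bilinearComp (q1 + S ∘L q1) q1 +
      (innerSL ℝ).bilinearComp (fp ∘L k) (fp ∘L k)
  have hB : ∀ u v, B u v = inner ℝ (q2 u) (W (q2 v)) + inner ℝ (q1 u + S (q1 u)) (q1 v) +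
      inner ℝ (fp (k u)) (fp (k v)) := fun u v => rfl
  have hnorm : ∀ u : V, ‖u‖ ^ 2 = ‖q1 u‖ ^ 2 + ‖q2 u‖ ^ 2 := fun u =>
    WithLp.prod_norm_sq_eq_of_L2 (u : WithLp 2 (X × Y))
  have hco : IsCoercive B := by
    refine ⟨min c 1, lt_min hc one_pos, fun u => ?_⟩
    rw [hB, mul_assoc, ← pow_two, hnorm, inner_add_left, real_inner_self_eq_norm_sq,
      real_inner_self_eq_norm_sq]
    nlinarith [hcW (q2 u), hS (q1 u), min_le_left c 1, min_le_right c 1, sq_nonneg ‖q1 u‖,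
      sq_nonneg ‖q2 u‖, sq_nonneg ‖fp (k u)‖,
      mul_le_mul_of_nonneg_right (min_le_left c 1) (sq_nonneg ‖q2 u‖),
      mul_le_mul_of_nonneg_right (min_le_right c 1) (sq_nonneg ‖q1 u‖)]
  obtain ⟨u, hu⟩ := hco.continuousLinearEquivOfBilin.surjective (k.adjoint l)
  have hmem : ∀ v : V, F (q1 v) = J' (C (q1 v) + W (q2 v)) := fun v =>
    sub_eq_zero.1 (LinearMap.mem_ker.1 v.2)
  refine ⟨q1 u, q2 u, hmem u, ?_⟩
  refine ext_inner_right ℝ fun w => ?_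
  obtain ⟨y, hy⟩ := hsurj (F w - C (J w))
  let v : V := ⟨WithLp.toLp 2 (J w, y), LinearMap.mem_ker.2 <| by
    change F (J w) - J' (C (J w) + W y) = 0
    rw [hy, hFJ]; simp⟩
  have h := hco.continuousLinearEquivOfBilin_apply u v
  have hk : k v = f (K w) := by
    change K' (C (J w) + W y) = _
    rw [hy, ← hFK]; simp
  have hq1 : q1 v = J w := rfl
  have hq2 : W (q2 v) = F w - C (J w) := hy
  have hku : K' (C (q1 u) + W (q2 u)) = k u := rfl
  rw [hu, hB, hq1, hq2, hk, ContinuousLinearMap.adjoint_inner_left, hk] at h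
  have hp : inner ℝ (fp (k u)) (fp (f (K w))) = inner ℝ (fp (k u)) (K w) := by
    rw [← ContinuousLinearMap.adjoint_inner_left, ← ContinuousLinearMap.adjoint_inner_left, hproj]
  rw [hp] at h
  rw [hku]
  simp only [inner_add_left, inner_sub_left, inner_sub_right, map_sub,
    ContinuousLinearMap.adjoint_inner_left] at h ⊢
  linarith

/-- Uniqueness for the abstract Euler–Lagrange system. -/
theorem abstractEL_unique (F C : X →L[ℝ] Y) (Fp : Y →L[ℝ] X) (J : X →L[ℝ] X) (J' : Y →L[ℝ] Y)
    (K : X →L[ℝ] E) (K' : Y →L[ℝ] G) (f : E →L[ℝ] G) (fp : G →L[ℝ] E)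
    (S : X →L[ℝ] X) (W : Y →L[ℝ] Y)
    (hFJ : ∀ x, F (J x) = J' (F x)) (hFpJ : ∀ y, Fp (J' y) = J (Fp y))
    (hFK : ∀ x, K' (F x) = f (K x)) (hFpK : ∀ y, K (Fp y) = fp (K' y))
    (hFF : ∀ x, F (Fp (F x)) = F x)
    (hPadj : ∀ x, F.adjoint (Fp.adjoint x) = Fp (F x))
    (hproj : ∀ y, f.adjoint (fp.adjoint (fp y)) = fp y)
    (hJ' : ∀ y, J' y = 0 → y = 0) (hJ : ∀ x, J.adjoint x = 0 → x = 0)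
    (hS : ∀ x, 0 ≤ inner ℝ (S x) x)
    (hW : ∃ c > 0, ∀ y, c * ‖y‖ ^ 2 ≤ inner ℝ y (W y)) (x : X) (y : Y)
    (hx : F x = J' (C x + W y))
    (hy : F.adjoint y = K.adjoint (-fp (K' (C x + W y))) +
        J.adjoint (C.adjoint y - S x - x)) : x = 0 ∧ y = 0 := by
  obtain ⟨c, hc, hcW⟩ := hW
  set a := C x + W y with ha
  set r := C.adjoint y - S x - x with hr
  have hsymm : ∀ u v, inner ℝ (Fp (F u)) v = inner ℝ u (Fp (F v)) := fun u v => by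
    rw [← hPadj u, ContinuousLinearMap.adjoint_inner_left, ContinuousLinearMap.adjoint_inner_left]
  have haa : F (Fp a) = a := by
    refine (sub_eq_zero.1 (hJ' _ ?_)).symm
    rw [map_sub, ← hFJ, ← hFpJ, ← hx, hFF, sub_self]
  have hrr : Fp (F r) = r := by
    refine (sub_eq_zero.1 (hJ _ ?_)).symm
    refine ext_inner_right ℝ fun w => ?_
    have h1 : inner ℝ (F.adjoint y) (w - Fp (F w)) = (0 : ℝ) := by
      rw [ContinuousLinearMap.adjoint_inner_left, map_sub, hFF, sub_self, inner_zero_right]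
    have h2 : inner ℝ (K.adjoint (-fp (K' a))) (w - Fp (F w)) = (0 : ℝ) := by
      have h3 : inner ℝ (fp (K' a)) (fp (f (K w))) = inner ℝ (fp (K' a)) (K w) := by
        rw [← ContinuousLinearMap.adjoint_inner_left, ← ContinuousLinearMap.adjoint_inner_left,
          hproj]
      rw [ContinuousLinearMap.adjoint_inner_left, map_sub, hFpK, hFK, inner_neg_left,
        inner_sub_right, h3, sub_self, neg_zero]
    rw [hy, inner_add_left, h2, zero_add, ContinuousLinearMap.adjoint_inner_left, map_sub,
      ← hFpJ, ← hFJ, inner_sub_right, ← hsymm] at h1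
    rw [ContinuousLinearMap.adjoint_inner_left, inner_sub_left, h1, inner_zero_left]
  have key : inner ℝ y a = -‖fp (K' a)‖ ^ 2 + inner ℝ r x := by
    rw [← haa, ← ContinuousLinearMap.adjoint_inner_left, hy, inner_add_left,
      ContinuousLinearMap.adjoint_inner_left, ContinuousLinearMap.adjoint_inner_left, hFpK,
      haa, inner_neg_left, real_inner_self_eq_norm_sq, ← hFpJ, ← hx, ← hsymm, hrr]
  rw [ha, hr, inner_add_right, inner_sub_left, inner_sub_left,
    ContinuousLinearMap.adjoint_inner_left, real_inner_self_eq_norm_sq] at key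
  have h1 := hS x
  have h2 := hcW y
  have h3 := sq_nonneg ‖fp (K' (C x + W y))‖
  have h4 : 0 ≤ c * ‖y‖ ^ 2 := by positivity
  have hx0 : ‖x‖ ^ 2 = 0 := le_antisymm (by linarith) (sq_nonneg _)
  have hy0 : c * ‖y‖ ^ 2 = 0 := le_antisymm (by linarith [sq_nonneg ‖x‖]) h4
  exact ⟨by simpa using hx0, by simpa [hc.ne'] using hy0⟩

end Abstract

section IntervalL2

variable {t0 T : ℝ} {E : Type*} [NormedAddCommGroup E]

/-- The Hilbert space `L²(t0,T;E)`. -/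
abbrev L2Icc (t0 T : ℝ) (E : Type*) [NormedAddCommGroup E] : Type _ :=
  Lp E 2 (volume.restrict (Icc t0 T))

theorem L2Icc.integrable (x : L2Icc t0 T E) : Integrable x (volume.restrict (Icc t0 T)) :=
  (Lp.memLp x).integrable one_le_two

theorem L2Icc.exists_integral_norm_le (t0 T : ℝ) (E : Type*) [NormedAddCommGroup E] :
    ∃ A : ℝ, 0 ≤ A ∧ ∀ x : L2Icc t0 T E, ∫ t in Icc t0 T, ‖x t‖ ≤ A * ‖x‖ := by
  set μ := volume.restrict (Icc t0 T)
  refine ⟨(μ univ ^ (1 / (1 : ℝ≥0∞).toReal - 1 / (2 : ℝ≥0∞).toReal)).toReal,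
    ENNReal.toReal_nonneg, fun x => ?_⟩
  have hx := Lp.memLp x
  have h := eLpNorm_le_eLpNorm_mul_rpow_measure_univ (one_le_two : (1 : ℝ≥0∞) ≤ 2)
    (Lp.aestronglyMeasurable x)
  rw [integral_norm_eq_lintegral_enorm (Lp.aestronglyMeasurable x),
    ← eLpNorm_one_eq_lintegral_enorm, Lp.norm_def, mul_comm, ← ENNReal.toReal_mul]
  refine ENNReal.toReal_mono (ENNReal.mul_ne_top hx.2.ne ?_) h
  exact ENNReal.rpow_ne_top_of_nonneg (by norm_num) (measure_ne_top _ _)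

theorem memLp_two_of_continuousOn {x : ℝ → E} (hx : ContinuousOn x (Icc t0 T)) :
    MemLp x 2 (volume.restrict (Icc t0 T)) := by
  obtain ⟨A, hA⟩ := isCompact_Icc.exists_bound_of_continuousOn hx
  exact MemLp.of_bound (hx.aestronglyMeasurable measurableSet_Icc) A
    ((ae_restrict_iff' measurableSet_Icc).2 (Eventually.of_forall hA))

theorem intervalIntegrable_of_Icc {x : ℝ → E}
    (hx : Integrable x (volume.restrict (Icc t0 T))) {a b : ℝ} (ha : a ∈ Icc t0 T)
    (hb : b ∈ Icc t0 T) : IntervalIntegrable x volume a b :=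
  IntegrableOn.intervalIntegrable (IntegrableOn.mono_set hx (uIcc_subset_Icc ha hb))

variable [NormedSpace ℝ E]

theorem norm_intervalIntegral_le_setIntegral_norm {x : ℝ → E}
    (hx : Integrable x (volume.restrict (Icc t0 T))) {a b : ℝ} (ha : a ∈ Icc t0 T)
    (hb : b ∈ Icc t0 T) :
    ‖∫ s in a..b, x s‖ ≤ ∫ s in Icc t0 T, ‖x s‖ := by
  refine intervalIntegral.norm_integral_le_integral_norm_uIoc.trans ?_
  refine setIntegral_mono_set hx.norm (Eventually.of_forall fun _ => norm_nonneg _) ?_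
  exact (uIoc_subset_uIcc.trans (uIcc_subset_Icc ha hb)).eventuallyLE

theorem continuousOn_integral_from_left {x : ℝ → E}
    (hx : Integrable x (volume.restrict (Icc t0 T))) :
    ContinuousOn (fun t => ∫ s in t0..t, x s) (Icc t0 T) := by
  rcases le_or_gt t0 T with h | h
  · have := intervalIntegral.continuousOn_primitive_interval (f := x) (μ := volume) (a := t0)
      (b := T) (by rwa [uIcc_of_le h])
    rwa [uIcc_of_le h] at this
  · simp [Icc_eq_empty_of_lt h]

theorem continuousOn_integral_to_right {x : ℝ → E}
    (hx : Integrable x (volume.restrict (Icc t0 T))) :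
    ContinuousOn (fun t => ∫ s in t..T, x s) (Icc t0 T) := by
  rcases le_or_gt t0 T with h | h
  · have := intervalIntegral.continuousOn_primitive_interval_left (f := x) (μ := volume) (a := t0)
      (b := T) (by rwa [uIcc_of_le h])
    rwa [uIcc_of_le h] at this
  · simp [Icc_eq_empty_of_lt h]

theorem intervalIntegral_congr_ae_Icc {x y : ℝ → E}
    (h : x =ᵐ[volume.restrict (Icc t0 T)] y) {a b : ℝ} (ha : a ∈ Icc t0 T) (hb : b ∈ Icc t0 T) :
    ∫ s in a..b, x s = ∫ s in a..b, y s :=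
  intervalIntegral.integral_congr_ae_restrict
    (ae_restrict_of_ae_restrict_of_subset (uIoc_subset_uIcc.trans (uIcc_subset_Icc ha hb)) h)

end IntervalL2

section Operators

variable {t0 T : ℝ} {E G : Type*}
  [NormedAddCommGroup E] [InnerProductSpace ℝ E] [NormedAddCommGroup G] [InnerProductSpace ℝ G]

theorem memLp_top_of_continuousOn {F : Type*} [NormedAddCommGroup F] {A : ℝ → F}
    (hA : ContinuousOn A (Icc t0 T)) : MemLp A ∞ (volume.restrict (Icc t0 T)) := by
  obtain ⟨c, hc⟩ := isCompact_Icc.exists_bound_of_continuousOn hA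
  exact MemLp.of_bound (hA.aestronglyMeasurable measurableSet_Icc) c
    ((ae_restrict_iff' measurableSet_Icc).2 (Eventually.of_forall hc))

/-- Pointwise application of a continuous operator-valued function, as an operator on `L²`. -/
def mulOp (A : ℝ → E →L[ℝ] G) (hA : ContinuousOn A (Icc t0 T)) :
    L2Icc t0 T E →L[ℝ] L2Icc t0 T G :=
  (ContinuousLinearMap.id ℝ (E →L[ℝ] G)).holderL (volume.restrict (Icc t0 T)) ∞ 2 2
    ((memLp_top_of_continuousOn hA).toLp A)

theorem coeFn_mulOp (A : ℝ → E →L[ℝ] G) (hA : ContinuousOn A (Icc t0 T)) (x : L2Icc t0 T E) :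
    mulOp A hA x =ᵐ[volume.restrict (Icc t0 T)] fun t => A t (x t) := by
  have h := (ContinuousLinearMap.id ℝ (E →L[ℝ] G)).coeFn_holder (r := 2)
    ((memLp_top_of_continuousOn hA).toLp A) x
  filter_upwards [h, MemLp.coeFn_toLp (memLp_top_of_continuousOn hA)] with t h1 h2
  rw [h2] at h1
  exact h1

theorem inner_mulOp_left (A : ℝ → E →L[ℝ] G) (hA : ContinuousOn A (Icc t0 T))
    (x : L2Icc t0 T E) (y : L2Icc t0 T G) :
    inner ℝ (mulOp A hA x) y = ∫ t in Icc t0 T, inner ℝ (A t (x t)) (y t) := by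
  rw [L2.inner_def]
  refine integral_congr_ae ?_
  filter_upwards [coeFn_mulOp A hA x] with t ht
  rw [ht]

theorem inner_mulOp_right (A : ℝ → E →L[ℝ] G) (hA : ContinuousOn A (Icc t0 T))
    (x : L2Icc t0 T E) (y : L2Icc t0 T G) :
    inner ℝ y (mulOp A hA x) = ∫ t in Icc t0 T, inner ℝ (y t) (A t (x t)) := by
  rw [L2.inner_def]
  refine integral_congr_ae ?_
  filter_upwards [coeFn_mulOp A hA x] with t ht
  rw [ht]

theorem mulOp_comp {D : Type*} [NormedAddCommGroup D] [InnerProductSpace ℝ D]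
    (A : ℝ → E →L[ℝ] G) (hA : ContinuousOn A (Icc t0 T)) (B : ℝ → D →L[ℝ] E)
    (hB : ContinuousOn B (Icc t0 T)) (x : L2Icc t0 T D) :
    mulOp A hA (mulOp B hB x) = mulOp (fun t => A t ∘L B t) (hA.clm_comp hB) x := by
  refine Lp.ext ?_
  filter_upwards [coeFn_mulOp A hA (mulOp B hB x), coeFn_mulOp B hB x,
    coeFn_mulOp _ (hA.clm_comp hB) x] with t h1 h2 h3
  rw [h1, h2, h3]; rfl

variable [CompleteSpace E] [CompleteSpace G]

/-- The Volterra operator `x ↦ ∫_{t0}^t x` on `L²(t0,T;E)`. -/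
def volterra (t0 T : ℝ) (E : Type*) [NormedAddCommGroup E] [InnerProductSpace ℝ E]
    [CompleteSpace E] : L2Icc t0 T E →L[ℝ] L2Icc t0 T E :=
  LinearMap.mkContinuousOfExistsBound
    { toFun := fun x => (memLp_two_of_continuousOn
        (continuousOn_integral_from_left x.integrable)).toLp _
      map_add' := fun x y => by
        rw [← MemLp.toLp_add]
        refine MemLp.toLp_congr _ _ ?_
        filter_upwards [ae_restrict_mem measurableSet_Icc] with t ht
        have h0 : t0 ∈ Icc t0 T := ⟨le_rfl, ht.1.trans ht.2⟩
        rw [Pi.add_apply, ← intervalIntegral.integral_add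
          (intervalIntegrable_of_Icc x.integrable h0 ht)
          (intervalIntegrable_of_Icc y.integrable h0 ht)]
        exact intervalIntegral_congr_ae_Icc (Lp.coeFn_add x y) h0 ht
      map_smul' := fun c x => by
        rw [RingHom.id_apply, ← MemLp.toLp_const_smul]
        refine MemLp.toLp_congr _ _ ?_
        filter_upwards [ae_restrict_mem measurableSet_Icc] with t ht
        have h0 : t0 ∈ Icc t0 T := ⟨le_rfl, ht.1.trans ht.2⟩
        rw [Pi.smul_apply, ← intervalIntegral.integral_smul]
        exact intervalIntegral_congr_ae_Icc (Lp.coeFn_smul c x) h0 ht } <| by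
    obtain ⟨A, hA0, hA⟩ := L2Icc.exists_integral_norm_le t0 T E
    refine ⟨measureUnivNNReal (volume.restrict (Icc t0 T)) ^ (2 : ℝ≥0∞).toReal⁻¹ * A,
      fun x => ?_⟩
    rw [mul_assoc]
    refine Lp.norm_le_of_ae_bound (by positivity) ?_
    filter_upwards [MemLp.coeFn_toLp (memLp_two_of_continuousOn
      (continuousOn_integral_from_left x.integrable)), ae_restrict_mem measurableSet_Icc]
      with t ht htI
    have h0 : t0 ∈ Icc t0 T := ⟨le_rfl, htI.1.trans htI.2⟩
    refine (le_of_eq (congrArg norm ht)).trans ?_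
    exact (norm_intervalIntegral_le_setIntegral_norm x.integrable h0 htI).trans (hA x)

theorem coeFn_volterra (x : L2Icc t0 T E) :
    volterra t0 T E x =ᵐ[volume.restrict (Icc t0 T)] fun t => ∫ s in t0..t, x s :=
  MemLp.coeFn_toLp (memLp_two_of_continuousOn (continuousOn_integral_from_left x.integrable))

/-- The integral `x ↦ ∫_{t0}^T x` on `L²(t0,T;E)`. -/
def totalIntegral (t0 T : ℝ) (E : Type*) [NormedAddCommGroup E] [InnerProductSpace ℝ E]
    [CompleteSpace E] : L2Icc t0 T E →L[ℝ] E :=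
  LinearMap.mkContinuousOfExistsBound
    { toFun := fun x => ∫ t in Icc t0 T, x t
      map_add' := fun x y => by
        rw [← integral_add x.integrable y.integrable]
        exact integral_congr_ae (Lp.coeFn_add x y)
      map_smul' := fun c x => by
        rw [RingHom.id_apply, ← integral_smul]
        exact integral_congr_ae (Lp.coeFn_smul c x) } <| by
    obtain ⟨A, -, hA⟩ := L2Icc.exists_integral_norm_le t0 T E
    exact ⟨A, fun x => (norm_integral_le_integral_norm _).trans (hA x)⟩

theorem totalIntegral_apply (x : L2Icc t0 T E) :
    totalIntegral t0 T E x = ∫ t in Icc t0 T, x t := rfl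

theorem mulOp_adjoint (A : ℝ → E →L[ℝ] G) (hA : ContinuousOn A (Icc t0 T))
    (B : ℝ → G →L[ℝ] E) (hB : ContinuousOn B (Icc t0 T)) (hAB : ∀ t, B t = (A t).adjoint) :
    (mulOp A hA).adjoint = mulOp B hB := by
  refine (ContinuousLinearMap.eq_adjoint_iff _ _ |>.2 fun y x => ?_).symm
  rw [inner_mulOp_left, inner_mulOp_right]
  simp only [hAB, ContinuousLinearMap.adjoint_inner_left]

theorem mulOp_const_volterra (A : E →L[ℝ] G) (x : L2Icc t0 T E) :
    mulOp (fun _ => A) continuousOn_const (volterra t0 T E x) =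
      volterra t0 T G (mulOp (fun _ => A) continuousOn_const x) := by
  refine Lp.ext ?_
  filter_upwards [coeFn_mulOp (fun _ => A) continuousOn_const (volterra t0 T E x),
    coeFn_volterra x, coeFn_volterra (mulOp (t0 := t0) (T := T) (fun _ => A) continuousOn_const x),
    ae_restrict_mem measurableSet_Icc] with t h1 h2 h3 ht
  have h0 : t0 ∈ Icc t0 T := ⟨le_rfl, ht.1.trans ht.2⟩
  rw [h1, h2, h3, intervalIntegral_congr_ae_Icc (coeFn_mulOp _ _ x) h0 ht,
    ContinuousLinearMap.intervalIntegral_comp_comm _ (intervalIntegrable_of_Icc x.integrable h0 ht)]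

theorem totalIntegral_mulOp_const (A : E →L[ℝ] G) (x : L2Icc t0 T E) :
    totalIntegral t0 T G (mulOp (fun _ => A) continuousOn_const x) =
      A (totalIntegral t0 T E x) := by
  rw [totalIntegral_apply, totalIntegral_apply, integral_congr_ae (coeFn_mulOp _ _ x),
    ContinuousLinearMap.integral_comp_comm _ x.integrable]

theorem coeFn_totalIntegral_adjoint (b : E) :
    (totalIntegral t0 T E).adjoint b =ᵐ[volume.restrict (Icc t0 T)] fun _ => b := by
  have hb : MemLp (fun _ : ℝ => b) 2 (volume.restrict (Icc t0 T)) := memLp_const b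
  have : (totalIntegral t0 T E).adjoint b = hb.toLp _ := by
    refine ext_inner_right ℝ fun w => ?_
    rw [ContinuousLinearMap.adjoint_inner_left, L2.inner_def, totalIntegral_apply,
      ← integral_inner w.integrable]
    refine integral_congr_ae ?_
    filter_upwards [hb.coeFn_toLp] with t ht
    rw [ht]
  rw [this]
  exact hb.coeFn_toLp

theorem coeFn_volterra_adjoint (x : L2Icc t0 T E) :
    (volterra t0 T E).adjoint x =ᵐ[volume.restrict (Icc t0 T)] fun t => ∫ s in t..T, x s := by
  have hx : MemLp (fun t => ∫ s in t..T, x s) 2 (volume.restrict (Icc t0 T)) :=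
    memLp_two_of_continuousOn (continuousOn_integral_to_right x.integrable)
  have : (volterra t0 T E).adjoint x = hx.toLp _ := by
    refine ext_inner_left ℝ fun w => ?_
    rw [ContinuousLinearMap.adjoint_inner_right, L2.inner_def, L2.inner_def]
    set μ := volume.restrict (Icc t0 T)
    let φ : ℝ → ℝ → ℝ := fun t s => if s ≤ t then inner ℝ (w s) (x t) else 0
    have hφ : Integrable (Function.uncurry φ) (μ.prod μ) := by
      have h1 : Integrable (fun q : ℝ × ℝ => ‖x q.1‖ * ‖w q.2‖) (μ.prod μ) :=
        x.integrable.norm.mul_prod w.integrable.norm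
      refine h1.mono ?_ (Eventually.of_forall fun q => ?_)
      · have h2 : AEStronglyMeasurable (fun q : ℝ × ℝ => inner ℝ (w q.2) (x q.1)) (μ.prod μ) :=
          (Lp.aestronglyMeasurable w).comp_snd.inner (Lp.aestronglyMeasurable x).comp_fst
        exact h2.indicator (measurableSet_le measurable_snd measurable_fst)
      · simp only [Function.uncurry, φ]
        split_ifs
        · rw [norm_mul, norm_norm, norm_norm, mul_comm]
          exact norm_inner_le_norm _ _
        · rw [norm_zero]; positivity
    have hL : ∫ t, inner ℝ (volterra t0 T E w t) (x t) ∂μ = ∫ t, ∫ s, φ t s ∂μ ∂μ := by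
      refine integral_congr_ae ?_
      filter_upwards [coeFn_volterra w, ae_restrict_mem measurableSet_Icc] with t h1 ht
      have : ∀ s, φ t s = (Iic t).indicator (fun s => inner ℝ (w s) (x t)) s := fun s => rfl
      simp only [this]
      rw [h1, integral_indicator measurableSet_Iic, Measure.restrict_restrict measurableSet_Iic,
        intervalIntegral.integral_of_le ht.1, ← integral_Icc_eq_integral_Ioc,
        show Iic t ∩ Icc t0 T = Icc t0 t by ext s; simp; grind]
      simp_rw [real_inner_comm (x t)]
      rw [integral_inner]
      exact IntegrableOn.mono_set w.integrable (Icc_subset_Icc_right ht.2)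
    have hR : ∫ s, inner ℝ (w s) (hx.toLp _ s) ∂μ = ∫ s, ∫ t, φ t s ∂μ ∂μ := by
      refine integral_congr_ae ?_
      filter_upwards [hx.coeFn_toLp, ae_restrict_mem measurableSet_Icc] with s h1 hs
      have : ∀ t, φ t s = (Ici s).indicator (fun t => inner ℝ (w s) (x t)) t := fun t => rfl
      simp only [this]
      rw [h1, integral_indicator measurableSet_Ici, Measure.restrict_restrict measurableSet_Ici,
        intervalIntegral.integral_of_le hs.2, ← integral_Icc_eq_integral_Ioc,
        show Ici s ∩ Icc t0 T = Icc s T by ext t; simp; grind]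
      rw [integral_inner]
      exact IntegrableOn.mono_set x.integrable (Icc_subset_Icc_left hs.1)
    rw [hL, hR, integral_integral_swap hφ]
  rw [this]
  exact hx.coeFn_toLp

theorem ae_eq_zero_of_integral_from_left_eq_const (hT : t0 < T) {x : ℝ → E}
    (hx : Integrable x (volume.restrict (Icc t0 T))) (c : E)
    (h : (fun t => ∫ s in t0..t, x s) =ᵐ[volume.restrict (Icc t0 T)] fun _ => c) :
    x =ᵐ[volume.restrict (Icc t0 T)] 0 := by
  have heq := Measure.eqOn_Icc_of_ae_eq volume hT.ne h (continuousOn_integral_from_left hx)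
    continuousOn_const
  have h0 : t0 ∈ Icc t0 T := left_mem_Icc.2 hT.le
  have hd := (intervalIntegrable_of_Icc hx h0 (right_mem_Icc.2 hT.le)).ae_hasDerivAt_integral
  rw [uIcc_of_le hT.le] at hd
  have hs : ∀ᵐ t ∂volume.restrict (Icc t0 T), t ∈ Ioo t0 T := by
    rw [← restrict_Ioo_eq_restrict_Icc]
    exact ae_restrict_mem measurableSet_Ioo
  filter_upwards [ae_restrict_of_ae hd, hs] with t ht hto
  have h1 := ht (Ioo_subset_Icc_self hto) t0 h0
  have h2 : HasDerivAt (fun t => ∫ s in t0..t, x s) 0 t :=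
    (hasDerivAt_const t c).congr_of_eventuallyEq
      (eventually_of_mem (Icc_mem_nhds hto.1 hto.2) heq)
  exact h1.unique h2

theorem volterra_injective (hT : t0 < T) (x : L2Icc t0 T E) (h : volterra t0 T E x = 0) :
    x = 0 := by
  refine Lp.ext ((ae_eq_zero_of_integral_from_left_eq_const hT x.integrable 0 ?_).trans
    (Lp.coeFn_zero _ _ _).symm)
  filter_upwards [coeFn_volterra x, Lp.coeFn_zero E 2 (volume.restrict (Icc t0 T))] with t h1 h2
  rw [← h1, h, h2]; rfl

theorem volterra_adjoint_injective (hT : t0 < T) (x : L2Icc t0 T E)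
    (h : (volterra t0 T E).adjoint x = 0) : x = 0 := by
  refine Lp.ext ((ae_eq_zero_of_integral_from_left_eq_const hT x.integrable
    (∫ s in t0..T, x s) ?_).trans (Lp.coeFn_zero _ _ _).symm)
  filter_upwards [coeFn_volterra_adjoint x, Lp.coeFn_zero E 2 (volume.restrict (Icc t0 T)),
    ae_restrict_mem measurableSet_Icc] with t h1 h2 ht
  rw [h, h2, Pi.zero_apply] at h1
  rw [← intervalIntegral.integral_add_adjacent_intervals
    (intervalIntegrable_of_Icc x.integrable (left_mem_Icc.2 hT.le) ht)
    (intervalIntegrable_of_Icc x.integrable ht (right_mem_Icc.2 hT.le)), ← h1, add_zero]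

end Operators

section Matrices

variable {a b c : ℕ}

/-- The operator between Euclidean spaces given by a matrix. -/
def matCLM (M : Matrix (Fin a) (Fin b) ℝ) :
    EuclideanSpace ℝ (Fin b) →L[ℝ] EuclideanSpace ℝ (Fin a) :=
  (toEuclideanLin M).toContinuousLinearMap

theorem ofLp_matCLM (M : Matrix (Fin a) (Fin b) ℝ) (x : EuclideanSpace ℝ (Fin b)) :
    WithLp.ofLp (matCLM M x) = M *ᵥ WithLp.ofLp x := rfl

theorem continuous_matCLM :
    Continuous (matCLM : Matrix (Fin a) (Fin b) ℝ → _) :=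
  ((toEuclideanLin (𝕜 := ℝ) (m := Fin a) (n := Fin b)).trans
    LinearMap.toContinuousLinearMap).toLinearMap.continuous_of_finiteDimensional

theorem matCLM_transpose (M : Matrix (Fin a) (Fin b) ℝ) : matCLM Mᵀ = (matCLM M).adjoint := by
  refine (ContinuousLinearMap.eq_adjoint_iff _ _).2 fun x y => ?_
  simp only [EuclideanSpace.inner_eq_star_dotProduct, ofLp_matCLM, star_trivial]
  rw [mulVec_transpose, dotProduct_comm, ← dotProduct_mulVec, dotProduct_comm]

theorem matCLM_mul (M : Matrix (Fin a) (Fin b) ℝ) (N : Matrix (Fin b) (Fin c) ℝ) :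
    matCLM (M * N) = matCLM M ∘L matCLM N := by
  ext x : 1
  apply WithLp.ofLp_injective
  simp [ofLp_matCLM]

theorem inner_matCLM_right (M : Matrix (Fin a) (Fin b) ℝ) (x : EuclideanSpace ℝ (Fin a))
    (y : EuclideanSpace ℝ (Fin b)) :
    inner ℝ x (matCLM M y) = WithLp.ofLp x ⬝ᵥ (M *ᵥ WithLp.ofLp y) := by
  rw [EuclideanSpace.inner_eq_star_dotProduct, ofLp_matCLM, star_trivial, dotProduct_comm]

end Matrices

section Coercive

variable {t0 T : ℝ}

theorem exists_coercive_bound {E : Type*} [NormedAddCommGroup E] [InnerProductSpace ℝ E]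
    [FiniteDimensional ℝ E] {A : ℝ → E →L[ℝ] E} (hA : ContinuousOn A (Icc t0 T))
    (hpos : ∀ t ∈ Icc t0 T, ∀ v, v ≠ 0 → 0 < inner ℝ v (A t v)) :
    ∃ c > 0, ∀ t ∈ Icc t0 T, ∀ v, c * ‖v‖ ^ 2 ≤ inner ℝ v (A t v) := by
  let s : Set (ℝ × E) := Icc t0 T ×ˢ Metric.sphere 0 1
  have hs : IsCompact s := isCompact_Icc.prod (isCompact_sphere 0 1)
  have hcont : ContinuousOn (fun q : ℝ × E => inner ℝ q.2 (A q.1 q.2)) s :=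
    continuousOn_snd.inner
      ((hA.comp continuousOn_fst fun q hq => hq.1).clm_apply continuousOn_snd)
  have hbd : ∃ c > 0, ∀ q ∈ s, c ≤ inner ℝ q.2 (A q.1 q.2) := by
    rcases s.eq_empty_or_nonempty with h | h
    · exact ⟨1, one_pos, by simp [h]⟩
    · obtain ⟨q, hq, hmin⟩ := hs.exists_isMinOn h hcont
      refine ⟨_, hpos q.1 hq.1 q.2 ?_, fun r hr => hmin hr⟩
      rintro h0
      have := hq.2
      simp [h0] at this
  obtain ⟨c, hc, hcs⟩ := hbd
  refine ⟨c, hc, fun t ht v => ?_⟩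
  rcases eq_or_ne v 0 with rfl | hv
  · simp
  have hn : ‖v‖ ≠ 0 := norm_ne_zero_iff.2 hv
  have h := hcs (t, ‖v‖⁻¹ • v) ⟨ht, by simp [norm_smul, hn]⟩
  simp only [map_smul, inner_smul_left, inner_smul_right, conj_trivial] at h
  have h2 := mul_le_mul_of_nonneg_right h (sq_nonneg ‖v‖)
  calc c * ‖v‖ ^ 2 ≤ _ := h2
    _ = _ := by field_simp

theorem mulOp_coercive {E : Type*} [NormedAddCommGroup E] [InnerProductSpace ℝ E]
    [FiniteDimensional ℝ E] {A : ℝ → E →L[ℝ] E} (hA : ContinuousOn A (Icc t0 T))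
    (hpos : ∀ t ∈ Icc t0 T, ∀ v, v ≠ 0 → 0 < inner ℝ v (A t v)) :
    ∃ c > 0, ∀ x : L2Icc t0 T E, c * ‖x‖ ^ 2 ≤ inner ℝ x (mulOp A hA x) := by
  obtain ⟨c, hc, h⟩ := exists_coercive_bound hA hpos
  refine ⟨c, hc, fun x => ?_⟩
  rw [← real_inner_self_eq_norm_sq, L2.inner_def, L2.inner_def, ← integral_const_mul]
  refine integral_mono_ae ((L2.integrable_inner x x).const_mul c)
    (L2.integrable_inner x (mulOp A hA x)) ?_
  filter_upwards [coeFn_mulOp A hA x, ae_restrict_mem measurableSet_Icc] with t h1 ht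
  rw [h1, real_inner_self_eq_norm_sq]
  exact h t ht _

theorem mulOp_nonneg {E : Type*} [NormedAddCommGroup E] [InnerProductSpace ℝ E]
    {A : ℝ → E →L[ℝ] E} (hA : ContinuousOn A (Icc t0 T))
    (hpos : ∀ t ∈ Icc t0 T, ∀ v, 0 ≤ inner ℝ v (A t v)) (x : L2Icc t0 T E) :
    0 ≤ inner ℝ (mulOp A hA x) x := by
  rw [real_inner_comm, inner_mulOp_right]
  exact setIntegral_nonneg measurableSet_Icc fun t ht => hpos t ht _

end Coercive

section Bridge

variable {t0 T : ℝ} {k : ℕ}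

theorem l2On_iff_memLp {E : Type*} [NormedAddCommGroup E] {x : ℝ → E} :
    L2On t0 T x ↔ MemLp x 2 (volume.restrict (Icc t0 T)) :=
  ⟨fun h => (memLp_two_iff_integrable_sq_norm h.1).2 h.2,
    fun h => ⟨h.1, (memLp_two_iff_integrable_sq_norm h.1).1 h⟩⟩

theorem L2On.memLp_toLp {φ : ℝ → Fin k → ℝ} (h : L2On t0 T φ) :
    MemLp (fun t => WithLp.toLp 2 (φ t)) 2 (volume.restrict (Icc t0 T)) :=
  (EuclideanSpace.equiv (Fin k) ℝ).symm.toContinuousLinearMap.comp_memLp' (l2On_iff_memLp.1 h)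

theorem l2On_ofLp (x : L2Icc t0 T (EuclideanSpace ℝ (Fin k))) :
    L2On t0 T (fun t => WithLp.ofLp (x t)) :=
  l2On_iff_memLp.2
    ((EuclideanSpace.equiv (Fin k) ℝ).toContinuousLinearMap.comp_memLp' (Lp.memLp x))

theorem L2On.congr {E : Type*} [NormedAddCommGroup E] {x y : ℝ → E} (hx : L2On t0 T x)
    (h : y =ᵐ[volume.restrict (Icc t0 T)] x) : L2On t0 T y :=
  l2On_iff_memLp.2 ((l2On_iff_memLp.1 hx).ae_eq h.symm)

variable {g : L2Icc t0 T (EuclideanSpace ℝ (Fin k))} {φ : ℝ → Fin k → ℝ}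

theorem integrable_of_coeFn_ae_eq (h : ∀ᵐ t ∂volume.restrict (Icc t0 T), WithLp.ofLp (g t) = φ t) :
    Integrable φ (volume.restrict (Icc t0 T)) :=
  ((EuclideanSpace.equiv (Fin k) ℝ).toContinuousLinearMap.integrable_comp g.integrable).congr h

theorem ofLp_intervalIntegral (h : ∀ᵐ t ∂volume.restrict (Icc t0 T), WithLp.ofLp (g t) = φ t)
    {u v : ℝ} (hu : u ∈ Icc t0 T) (hv : v ∈ Icc t0 T) :
    WithLp.ofLp (∫ s in u..v, g s) = ∫ s in u..v, φ s := by
  rw [← intervalIntegral_congr_ae_Icc h hu hv]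
  exact ((EuclideanSpace.equiv (Fin k) ℝ).toContinuousLinearMap.intervalIntegral_comp_comm
    (intervalIntegrable_of_Icc g.integrable hu hv)).symm

/-- If `M x = h` almost everywhere with `h` continuous, then `x` may be changed on a null set so that
the equality holds everywhere. -/
theorem exists_ae_eq_mulVec_eqOn {a b : ℕ} (hT : t0 < T) {M : Matrix (Fin a) (Fin b) ℝ}
    {Mp : Matrix (Fin b) (Fin a) ℝ} (hM : M * Mp * M = M) {x : ℝ → Fin b → ℝ}
    {h : ℝ → Fin a → ℝ} (hh : ContinuousOn h (Icc t0 T))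
    (hx : ∀ᵐ t ∂volume.restrict (Icc t0 T), M *ᵥ x t = h t) :
    ∃ x' : ℝ → Fin b → ℝ, x' =ᵐ[volume.restrict (Icc t0 T)] x ∧
      ∀ t ∈ Icc t0 T, M *ᵥ x' t = h t := by
  classical
  have hr : EqOn (fun t => (M * Mp) *ᵥ h t) h (Icc t0 T) := by
    refine Measure.eqOn_Icc_of_ae_eq volume hT.ne ?_ ?_ hh
    · filter_upwards [hx] with t ht
      rw [← ht, mulVec_mulVec, hM]
    · exact (Continuous.matrix_mulVec continuous_const continuous_id).comp_continuousOn hh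
  refine ⟨fun t => if M *ᵥ x t = h t then x t else Mp *ᵥ h t, ?_, fun t ht => ?_⟩
  · filter_upwards [hx] with t ht
    rw [if_pos ht]
  · dsimp only
    split_ifs with h1
    · exact h1
    · rw [mulVec_mulVec]; exact hr ht

end Bridge

section Coefficients

variable {m n p : ℕ} {t0 T ε : ℝ}

theorem continuousOn_smul_matrix_inv {Q : ℝ → Matrix (Fin m) (Fin m) ℝ}
    (hQ : ContinuousOn Q (Icc t0 T)) (hQpd : ∀ t ∈ Icc t0 T, (Q t).PosDef) (ε : ℝ) :
    ContinuousOn (fun t => ε • (Q t)⁻¹) (Icc t0 T) := by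
  refine ContinuousOn.const_smul (fun t ht => ?_) ε
  refine ContinuousAt.comp_continuousWithinAt (g := Inv.inv) ?_ (hQ t ht)
  refine continuousAt_matrix_inv _ ?_
  have hdet : (Q t).det ≠ 0 := (hQpd t ht).det_pos.ne'
  simpa only [Ring.inverse_eq_inv'] using continuousAt_inv₀ hdet

theorem continuousOn_smul_transpose_mul_mul {H : ℝ → Matrix (Fin p) (Fin n) ℝ}
    {R : ℝ → Matrix (Fin p) (Fin p) ℝ} (hH : ContinuousOn H (Icc t0 T))
    (hR : ContinuousOn R (Icc t0 T)) (c : ℝ) :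
    ContinuousOn (fun t => c • ((H t)ᵀ * (R t * H t))) (Icc t0 T) := by
  have hcont : Continuous fun q : Matrix (Fin p) (Fin n) ℝ × Matrix (Fin p) (Fin p) ℝ =>
      c • (q.1ᵀ * (q.2 * q.1)) :=
    (continuous_fst.matrix_transpose.matrix_mul
      (continuous_snd.matrix_mul continuous_fst)).const_smul c
  exact Continuous.comp_continuousOn' (f := fun t => (H t, R t)) hcont (hH.prodMk hR)

theorem inner_matCLM_smul_transpose_mul_mul_nonneg (H : Matrix (Fin p) (Fin n) ℝ)
    {R : Matrix (Fin p) (Fin p) ℝ} (hR : R.PosDef) {c : ℝ} (hc : 0 ≤ c)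
    (v : EuclideanSpace ℝ (Fin n)) : 0 ≤ inner ℝ v (matCLM (c • (Hᵀ * (R * H))) v) := by
  have h := hR.posSemidef.dotProduct_mulVec_nonneg (H *ᵥ WithLp.ofLp v)
  rw [star_trivial] at h
  rw [inner_matCLM_right, smul_mulVec, dotProduct_smul, ← mulVec_mulVec, ← mulVec_mulVec,
    dotProduct_mulVec, vecMul_transpose]
  exact smul_nonneg hc h

theorem inner_matCLM_smul_inv_pos {Q : Matrix (Fin m) (Fin m) ℝ} (hQ : Q.PosDef) (hε : 0 < ε)
    (v : EuclideanSpace ℝ (Fin m)) (hv : v ≠ 0) : 0 < inner ℝ v (matCLM (ε • Q⁻¹) v) := by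
  have h := hQ.inv.dotProduct_mulVec_pos (x := WithLp.ofLp v) ((WithLp.ofLp_eq_zero 2).not.2 hv)
  rw [star_trivial] at h
  rw [inner_matCLM_right, smul_mulVec, dotProduct_smul]
  exact smul_pos hε h

end Coefficients

section EulerLagrange

variable {m n : ℕ} {t0 T : ℝ}

theorem adjoint_mulOp_matCLM {a b : ℕ} {M : ℝ → Matrix (Fin a) (Fin b) ℝ}
    (hM : ContinuousOn M (Icc t0 T)) :
    (mulOp (t0 := t0) (T := T) (fun t => matCLM (M t))
      (continuous_matCLM.comp_continuousOn hM)).adjoint =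
    mulOp (fun t => matCLM (M t)ᵀ) (continuous_matCLM.comp_continuousOn
      (continuous_id.matrix_transpose.comp_continuousOn hM)) :=
  mulOp_adjoint _ _ _ _ fun t => matCLM_transpose (M t)

theorem ofLp_mulOp_matCLM {a b : ℕ} {M : ℝ → Matrix (Fin a) (Fin b) ℝ}
    (hM : ContinuousOn (fun t => matCLM (M t)) (Icc t0 T))
    {x : L2Icc t0 T (EuclideanSpace ℝ (Fin b))} {φ : ℝ → Fin b → ℝ}
    (hx : ∀ᵐ t ∂volume.restrict (Icc t0 T), WithLp.ofLp (x t) = φ t) :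
    ∀ᵐ t ∂volume.restrict (Icc t0 T), WithLp.ofLp (mulOp (fun t => matCLM (M t)) hM x t) =
      M t *ᵥ φ t := by
  filter_upwards [coeFn_mulOp _ hM x, hx] with t h1 h2
  rw [h1, ofLp_matCLM, h2]

theorem volterra_equation_iff (F : Matrix (Fin m) (Fin n) ℝ)
    {x : L2Icc t0 T (EuclideanSpace ℝ (Fin n))} {v : L2Icc t0 T (EuclideanSpace ℝ (Fin m))}
    {pe : ℝ → Fin n → ℝ} {φ : ℝ → Fin m → ℝ}
    (hx : ∀ᵐ t ∂volume.restrict (Icc t0 T), WithLp.ofLp (x t) = pe t)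
    (hv : ∀ᵐ t ∂volume.restrict (Icc t0 T), WithLp.ofLp (v t) = φ t) :
    mulOp (fun _ => matCLM F) continuousOn_const x = volterra t0 T _ v ↔
      ∀ᵐ t ∂volume.restrict (Icc t0 T), F *ᵥ pe t = ∫ s in t0..t, φ s := by
  rw [Lp.ext_iff]
  refine Filter.eventually_congr ?_
  filter_upwards [ofLp_mulOp_matCLM (M := fun _ => F) continuousOn_const hx, coeFn_volterra v,
    ae_restrict_mem measurableSet_Icc] with t h1 h2 ht
  rw [← h1, ← ofLp_intervalIntegral hv ⟨le_rfl, ht.1.trans ht.2⟩ ht, ← h2]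
  exact (WithLp.ofLp_injective 2).eq_iff.symm

theorem adjoint_equation_iff (F : Matrix (Fin m) (Fin n) ℝ)
    {y : L2Icc t0 T (EuclideanSpace ℝ (Fin m))} {r : L2Icc t0 T (EuclideanSpace ℝ (Fin n))}
    {z : ℝ → Fin m → ℝ} {ψ : ℝ → Fin n → ℝ} {β : EuclideanSpace ℝ (Fin n)} {b : Fin n → ℝ}
    (hy : ∀ᵐ t ∂volume.restrict (Icc t0 T), WithLp.ofLp (y t) = z t)
    (hr : ∀ᵐ t ∂volume.restrict (Icc t0 T), WithLp.ofLp (r t) = -ψ t)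
    (hβ : WithLp.ofLp β = b) :
    (mulOp (t0 := t0) (T := T) (fun _ => matCLM F) continuousOn_const).adjoint y =
        (totalIntegral t0 T _).adjoint β + (volterra t0 T _).adjoint r ↔
      ∀ᵐ t ∂volume.restrict (Icc t0 T), Fᵀ *ᵥ z t = b - ∫ s in t..T, ψ s := by
  have hadj : (mulOp (t0 := t0) (T := T) (fun _ => matCLM F) continuousOn_const).adjoint =
      mulOp (fun _ => matCLM Fᵀ) continuousOn_const :=
    adjoint_mulOp_matCLM (M := fun _ => F) continuousOn_const
  rw [Lp.ext_iff, hadj]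
  refine Filter.eventually_congr ?_
  filter_upwards [ofLp_mulOp_matCLM (M := fun _ => Fᵀ) continuousOn_const hy,
    Lp.coeFn_add ((totalIntegral t0 T _).adjoint β) ((volterra t0 T _).adjoint r),
    coeFn_totalIntegral_adjoint (t0 := t0) (T := T) β, coeFn_volterra_adjoint r,
    ae_restrict_mem measurableSet_Icc] with t h1 h2 h3 h4 ht
  rw [← h1, h2, Pi.add_apply, h3, h4, sub_eq_add_neg, ← intervalIntegral.integral_neg,
    ← ofLp_intervalIntegral hr ht ⟨ht.1.trans ht.2, le_rfl⟩, ← hβ, ← WithLp.ofLp_add 2]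
  exact (WithLp.ofLp_injective 2).eq_iff.symm

end EulerLagrange

/-- Proposition 1, Tikhonov regularization: existence and uniqueness.
For `ℓ ∈ 𝓛(T)` and `ε > 0` the Euler–Lagrange system has exactly one solution pair
(as elements of `L²`, i.e. up to a.e. equality). -/
theorem eulerLagrange_existsUnique
    {m n p : ℕ} (t0 T : ℝ) (hT : t0 < T)
    (F : Matrix (Fin m) (Fin n) ℝ)
    (C : ℝ → Matrix (Fin m) (Fin n) ℝ) (hC : ContinuousOn C (Icc t0 T))
    (H : ℝ → Matrix (Fin p) (Fin n) ℝ) (hH : ContinuousOn H (Icc t0 T))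
    (Q : ℝ → Matrix (Fin m) (Fin m) ℝ) (hQ : ContinuousOn Q (Icc t0 T))
    (hQpd : ∀ t ∈ Icc t0 T, (Q t).PosDef)
    (R : ℝ → Matrix (Fin p) (Fin p) ℝ) (hR : ContinuousOn R (Icc t0 T))
    (hRpd : ∀ t ∈ Icc t0 T, (R t).PosDef)
    (Fplus : Matrix (Fin n) (Fin m) ℝ) (hFplus : IsMoorePenrose F Fplus)
    (ℓ : Fin m → ℝ) (hℓ : sigmaHat t0 T F C H Q R ℓ < ⊤)
    (ε : ℝ) (hε : 0 < ε) :
    ∃ (pe : ℝ → (Fin n → ℝ)) (z : ℝ → (Fin m → ℝ)),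
      SolvesEL t0 T F Fplus C H Q R ε ℓ pe z ∧
      ∀ (pe' : ℝ → (Fin n → ℝ)) (z' : ℝ → (Fin m → ℝ)),
        SolvesEL t0 T F Fplus C H Q R ε ℓ pe' z' →
          pe' =ᵐ[MeasureTheory.volume.restrict (Icc t0 T)] pe ∧
          z' =ᵐ[MeasureTheory.volume.restrict (Icc t0 T)] z := by
  have h0 : t0 ∈ Icc t0 T := left_mem_Icc.2 hT.le
  have h1 : T ∈ Icc t0 T := right_mem_Icc.2 hT.le
  obtain ⟨hM1, hM2, hM3, hM4⟩ := hFplus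
  have hQinv := continuousOn_smul_matrix_inv hQ hQpd ε
  have hHRH := continuousOn_smul_transpose_mul_mul hH hR (1 / ε)
  let Fo := mulOp (t0 := t0) (T := T) (fun _ => matCLM F) continuousOn_const
  let Fpo := mulOp (t0 := t0) (T := T) (fun _ => matCLM Fplus) continuousOn_const
  let Co := mulOp (fun t => matCLM (C t)) (continuous_matCLM.comp_continuousOn hC)
  let S := mulOp _ (continuous_matCLM.comp_continuousOn hHRH)
  let W := mulOp _ (continuous_matCLM.comp_continuousOn hQinv)
  have hS : ∀ x, 0 ≤ inner ℝ (S x) x := mulOp_nonneg _ fun t ht =>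
    inner_matCLM_smul_transpose_mul_mul_nonneg (H t) (hRpd t ht) (one_div_pos.2 hε).le
  have hW : ∃ c > 0, ∀ y, c * ‖y‖ ^ 2 ≤ inner ℝ y (W y) := mulOp_coercive _ fun t ht =>
    inner_matCLM_smul_inv_pos (hQpd t ht) hε
  have hproj : ∀ y, (matCLM F).adjoint ((matCLM Fplus).adjoint (matCLM Fplus y)) =
      matCLM Fplus y := fun y => by
    rw [← matCLM_transpose, ← matCLM_transpose, ← ContinuousLinearMap.comp_apply,
      ← ContinuousLinearMap.comp_apply, ← matCLM_mul, ← matCLM_mul, ← transpose_mul, hM4, hM2]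
  have hFF : ∀ x, Fo (Fpo (Fo x)) = Fo x := fun x => by
    simp only [Fo, Fpo, mulOp_comp, ← matCLM_mul, ← Matrix.mul_assoc, hM1]
  have hPadj : ∀ x, Fo.adjoint (Fpo.adjoint x) = Fpo (Fo x) := fun x => by
    have e1 := adjoint_mulOp_matCLM (t0 := t0) (T := T) (M := fun _ => F) continuousOn_const
    have e2 := adjoint_mulOp_matCLM (t0 := t0) (T := T) (M := fun _ => Fplus) continuousOn_const
    simp only [Fo, Fpo, e1, e2, mulOp_comp, ← matCLM_mul, ← transpose_mul, hM4]
  -- identification of the two right-hand sides with elements of `L²`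
  have hrhs1 : ∀ (x : L2Icc t0 T (EuclideanSpace ℝ (Fin n)))
      (y : L2Icc t0 T (EuclideanSpace ℝ (Fin m))) (pe : ℝ → Fin n → ℝ) (z : ℝ → Fin m → ℝ),
      (∀ᵐ t ∂volume.restrict (Icc t0 T), WithLp.ofLp (x t) = pe t) →
      (∀ᵐ t ∂volume.restrict (Icc t0 T), WithLp.ofLp (y t) = z t) →
      ∀ᵐ t ∂volume.restrict (Icc t0 T), WithLp.ofLp ((Co x + W y) t) =
        C t *ᵥ pe t + ε • ((Q t)⁻¹ *ᵥ z t) := by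
    intro x y pe z hx hy
    filter_upwards [Lp.coeFn_add (Co x) (W y),
      ofLp_mulOp_matCLM (continuous_matCLM.comp_continuousOn hC) hx,
      ofLp_mulOp_matCLM (continuous_matCLM.comp_continuousOn hQinv) hy] with t e1 e2 e3
    rw [e1, Pi.add_apply, WithLp.ofLp_add, ← smul_mulVec, ← e2, ← e3]
    rfl
  have hrhs2 : ∀ (x : L2Icc t0 T (EuclideanSpace ℝ (Fin n)))
      (y : L2Icc t0 T (EuclideanSpace ℝ (Fin m))) (pe : ℝ → Fin n → ℝ) (z : ℝ → Fin m → ℝ),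
      (∀ᵐ t ∂volume.restrict (Icc t0 T), WithLp.ofLp (x t) = pe t) →
      (∀ᵐ t ∂volume.restrict (Icc t0 T), WithLp.ofLp (y t) = z t) →
      ∀ᵐ t ∂volume.restrict (Icc t0 T), WithLp.ofLp ((Co.adjoint y - S x - x) t) =
        -(-((C t)ᵀ *ᵥ z t) + (H t)ᵀ *ᵥ ((1 / ε) • ((R t) *ᵥ ((H t) *ᵥ pe t))) + pe t) := by
    intro x y pe z hx hy
    have hCadj := adjoint_mulOp_matCLM hC
    filter_upwards [Lp.coeFn_sub (Co.adjoint y - S x) x, Lp.coeFn_sub (Co.adjoint y) (S x),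
      ofLp_mulOp_matCLM (continuous_matCLM.comp_continuousOn
        (continuous_id.matrix_transpose.comp_continuousOn hC)) hy,
      ofLp_mulOp_matCLM (continuous_matCLM.comp_continuousOn hHRH) hx, hx] with t e1 e2 e3 e4 e5
    rw [e1, Pi.sub_apply, e2, Pi.sub_apply, WithLp.ofLp_sub, WithLp.ofLp_sub, e5]
    have e3' : WithLp.ofLp (Co.adjoint y t) = (C t)ᵀ *ᵥ z t := by
      simp only [Co, hCadj]
      exact e3
    have e4' : WithLp.ofLp (S x t) = (H t)ᵀ *ᵥ ((1 / ε) • ((R t) *ᵥ ((H t) *ᵥ pe t))) := by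
      rw [mulVec_smul, mulVec_mulVec, mulVec_mulVec, Matrix.mul_assoc, ← smul_mulVec, ← e4]
      rfl
    rw [e3', e4']
    abel
  have hbdry : ∀ (v : L2Icc t0 T (EuclideanSpace ℝ (Fin m))) (φ : ℝ → Fin m → ℝ),
      (∀ᵐ t ∂volume.restrict (Icc t0 T), WithLp.ofLp (v t) = φ t) →
      WithLp.ofLp ((matCLM F).adjoint (WithLp.toLp 2 ℓ) -
        matCLM Fplus (totalIntegral t0 T _ v)) =
        Fᵀ *ᵥ ℓ - Fplus *ᵥ ∫ s in t0..T, φ s := by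
    intro v φ hv
    rw [WithLp.ofLp_sub, ← matCLM_transpose, ofLp_matCLM, ofLp_matCLM, totalIntegral_apply,
      ← ofLp_intervalIntegral hv h0 h1, intervalIntegral.integral_of_le hT.le,
      integral_Icc_eq_integral_Ioc]
  obtain ⟨x, y, hx, hy⟩ := abstractEL_exists Fo Co (volterra t0 T _) (volterra t0 T _)
    (totalIntegral t0 T _) (totalIntegral t0 T _) (matCLM F) (matCLM Fplus) S W
    (mulOp_const_volterra _) (totalIntegral_mulOp_const _) hproj hS hW (WithLp.toLp 2 ℓ)
  have hxo : ∀ᵐ t ∂volume.restrict (Icc t0 T), WithLp.ofLp (x t) = WithLp.ofLp (x t) :=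
    Eventually.of_forall fun _ => rfl
  have hyo : ∀ᵐ t ∂volume.restrict (Icc t0 T), WithLp.ofLp (y t) = WithLp.ofLp (y t) :=
    Eventually.of_forall fun _ => rfl
  have r1 := hrhs1 x y _ _ hxo hyo
  have r2 := hrhs2 x y _ _ hxo hyo
  obtain ⟨pe, hpe, hpeq⟩ := exists_ae_eq_mulVec_eqOn hT hM1
    (continuousOn_integral_from_left (integrable_of_coeFn_ae_eq r1))
    ((volterra_equation_iff F hxo r1).1 hx)
  have hM1t : Fᵀ * Fplusᵀ * Fᵀ = Fᵀ := by
    rw [← transpose_mul, ← transpose_mul, ← Matrix.mul_assoc, hM1]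
  obtain ⟨z, hz, hzeq⟩ := exists_ae_eq_mulVec_eqOn hT hM1t
    (continuousOn_const.sub (continuousOn_integral_to_right
      ((integrable_of_coeFn_ae_eq r2).neg.congr (Eventually.of_forall fun t => neg_neg _))))
    ((adjoint_equation_iff F hyo r2 (hbdry _ _ r1)).1 hy)
  refine ⟨pe, z, ⟨(l2On_ofLp x).congr hpe, (l2On_ofLp y).congr hz, fun t ht => ?_,
    fun t ht => ?_⟩, fun pe' z' h => ?_⟩
  · rw [hpeq t ht]
    refine intervalIntegral_congr_ae_Icc ?_ h0 ht
    filter_upwards [hpe, hz] with s e1 e2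
    rw [e1, e2]
  · rw [hzeq t ht, hpeq T h1, Pi.sub_apply]
    refine congrArg _ ?_
    refine intervalIntegral_congr_ae_Icc ?_ ht h1
    filter_upwards [hpe, hz] with s e1 e2
    rw [e1, e2]
  · obtain ⟨hpL, hzL, hp', hz'⟩ := h
    obtain ⟨x', hx'⟩ : ∃ x' : L2Icc t0 T (EuclideanSpace ℝ (Fin n)),
        ∀ᵐ t ∂volume.restrict (Icc t0 T), WithLp.ofLp (x' t) = pe' t :=
      ⟨hpL.memLp_toLp.toLp, hpL.memLp_toLp.coeFn_toLp.mono fun t e => by rw [e]⟩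
    obtain ⟨y', hy'⟩ : ∃ y' : L2Icc t0 T (EuclideanSpace ℝ (Fin m)),
        ∀ᵐ t ∂volume.restrict (Icc t0 T), WithLp.ofLp (y' t) = z' t :=
      ⟨hzL.memLp_toLp.toLp, hzL.memLp_toLp.coeFn_toLp.mono fun t e => by rw [e]⟩
    have q1 := hrhs1 x' y' _ _ hx' hy'
    have q2 := hrhs2 x' y' _ _ hx' hy'
    have E1 : Fo x' = volterra t0 T _ (Co x' + W y') :=
      (volterra_equation_iff F hx' q1).2 ((ae_restrict_mem measurableSet_Icc).mono hp')
    rw [hp' T h1] at hz'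
    have E2 := (adjoint_equation_iff F hy' q2 (hbdry _ _ q1)).2
      ((ae_restrict_mem measurableSet_Icc).mono hz')
    have hd1 : Fo (x' - x) = volterra t0 T _ (Co (x' - x) + W (y' - y)) := by
      rw [map_sub, E1, hx, ← map_sub]
      congr 1
      rw [map_sub, map_sub]
      abel
    have hd2 : Fo.adjoint (y' - y) = (totalIntegral t0 T _).adjoint
        (-matCLM Fplus (totalIntegral t0 T _ (Co (x' - x) + W (y' - y)))) +
          (volterra t0 T _).adjoint (Co.adjoint (y' - y) - S (x' - x) - (x' - x)) := by
      rw [map_sub, hy]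
      refine (congrArg (· - _) E2).trans ?_
      simp only [map_sub, map_add, map_neg]
      abel
    obtain ⟨hxx, hyy⟩ := abstractEL_unique Fo Co Fpo (volterra t0 T _) (volterra t0 T _)
      (totalIntegral t0 T _) (totalIntegral t0 T _) (matCLM F) (matCLM Fplus) S W
      (mulOp_const_volterra _) (mulOp_const_volterra _) (totalIntegral_mulOp_const _)
      (totalIntegral_mulOp_const _) hFF hPadj hproj (volterra_injective hT)
      (volterra_adjoint_injective hT) hS hW (x' - x) (y' - y) hd1 hd2
    rw [sub_eq_zero] at hxx hyy
    subst hxx hyy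
    constructor
    · filter_upwards [hx', hpe] with t e1 e2
      rw [e2, e1]
    · filter_upwards [hy', hz] with t e1 e2
      rw [e2, e1]
end
end

section
/- For every t ∈ [t0,T] and every ε > 0, the matrices Q(t,ε) = −(1/ε)A(t)M(t,ε)A'(t) + I + (1/ε)(S1 + C3'Q4⁻¹C3) and S(t,ε) = ε(Q1 − Q2Q4⁻¹Q2' + B'(t)M(t,ε)B(t)) are symmetric positive semidefinite. (Matrix positivity claims in the proof of Corollary 1 (the suboptimal estimator): these make the Hamiltonian system non-negative for every ε > 0.) -/
open Matrix Set
open scoped ENNReal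

noncomputable section

section BlockDefs

variable {r mr nr : ℕ}

/-- `A(t) = C3'Q4⁻¹C4 + S2` (blocks taken conformally with `F = [[I,0],[0,0]]`,
`Sm = H'RH`). -/
def blkA (Cm : Matrix (Fin r ⊕ Fin mr) (Fin r ⊕ Fin nr) ℝ)
    (Qm : Matrix (Fin r ⊕ Fin mr) (Fin r ⊕ Fin mr) ℝ)
    (Sm : Matrix (Fin r ⊕ Fin nr) (Fin r ⊕ Fin nr) ℝ) : Matrix (Fin r) (Fin nr) ℝ :=
  (Cm.toBlocks₂₁)ᵀ * (Qm.toBlocks₂₂)⁻¹ * Cm.toBlocks₂₂ + Sm.toBlocks₁₂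

/-- `B(t) = C2' − C4'Q4⁻¹Q2'`. -/
def blkB (Cm : Matrix (Fin r ⊕ Fin mr) (Fin r ⊕ Fin nr) ℝ)
    (Qm : Matrix (Fin r ⊕ Fin mr) (Fin r ⊕ Fin mr) ℝ) : Matrix (Fin nr) (Fin r) ℝ :=
  (Cm.toBlocks₁₂)ᵀ - (Cm.toBlocks₂₂)ᵀ * (Qm.toBlocks₂₂)⁻¹ * (Qm.toBlocks₁₂)ᵀ

/-- `W(t,ε) = εI + S4 + C4'Q4⁻¹C4`. -/
def blkW (Cm : Matrix (Fin r ⊕ Fin mr) (Fin r ⊕ Fin nr) ℝ)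
    (Qm : Matrix (Fin r ⊕ Fin mr) (Fin r ⊕ Fin mr) ℝ)
    (Sm : Matrix (Fin r ⊕ Fin nr) (Fin r ⊕ Fin nr) ℝ) (ε : ℝ) :
    Matrix (Fin nr) (Fin nr) ℝ :=
  ε • (1 : Matrix (Fin nr) (Fin nr) ℝ) + Sm.toBlocks₂₂ +
    (Cm.toBlocks₂₂)ᵀ * (Qm.toBlocks₂₂)⁻¹ * Cm.toBlocks₂₂

/-- `C(t,ε) = −C1' + C3'Q4⁻¹Q2' + A M B`, `M = W(t,ε)⁻¹`. -/
def blkC (Cm : Matrix (Fin r ⊕ Fin mr) (Fin r ⊕ Fin nr) ℝ)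
    (Qm : Matrix (Fin r ⊕ Fin mr) (Fin r ⊕ Fin mr) ℝ)
    (Sm : Matrix (Fin r ⊕ Fin nr) (Fin r ⊕ Fin nr) ℝ) (ε : ℝ) :
    Matrix (Fin r) (Fin r) ℝ :=
  -(Cm.toBlocks₁₁)ᵀ + (Cm.toBlocks₂₁)ᵀ * (Qm.toBlocks₂₂)⁻¹ * (Qm.toBlocks₁₂)ᵀ +
    blkA Cm Qm Sm * (blkW Cm Qm Sm ε)⁻¹ * blkB Cm Qm

/-- `Q(t,ε) = −(1/ε)AMA' + I + (1/ε)(S1 + C3'Q4⁻¹C3)`. -/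
def blkQ (Cm : Matrix (Fin r ⊕ Fin mr) (Fin r ⊕ Fin nr) ℝ)
    (Qm : Matrix (Fin r ⊕ Fin mr) (Fin r ⊕ Fin mr) ℝ)
    (Sm : Matrix (Fin r ⊕ Fin nr) (Fin r ⊕ Fin nr) ℝ) (ε : ℝ) :
    Matrix (Fin r) (Fin r) ℝ :=
  -((1 / ε) • (blkA Cm Qm Sm * (blkW Cm Qm Sm ε)⁻¹ * (blkA Cm Qm Sm)ᵀ)) + 1 +
    (1 / ε) • (Sm.toBlocks₁₁ + (Cm.toBlocks₂₁)ᵀ * (Qm.toBlocks₂₂)⁻¹ * Cm.toBlocks₂₁)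

/-- `S(t,ε) = ε(Q1 − Q2Q4⁻¹Q2' + B'MB)`. -/
def blkS (Cm : Matrix (Fin r ⊕ Fin mr) (Fin r ⊕ Fin nr) ℝ)
    (Qm : Matrix (Fin r ⊕ Fin mr) (Fin r ⊕ Fin mr) ℝ)
    (Sm : Matrix (Fin r ⊕ Fin nr) (Fin r ⊕ Fin nr) ℝ) (ε : ℝ) :
    Matrix (Fin r) (Fin r) ℝ :=
  ε • (Qm.toBlocks₁₁ - Qm.toBlocks₁₂ * (Qm.toBlocks₂₂)⁻¹ * (Qm.toBlocks₁₂)ᵀ +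
    (blkB Cm Qm)ᵀ * (blkW Cm Qm Sm ε)⁻¹ * blkB Cm Qm)

end BlockDefs

/-- A positive semidefinite block matrix with positive definite lower right block has a
positive semidefinite Schur complement. -/
theorem Matrix.PosSemidef.schurComplement₂₂ {k l : Type*} [Fintype k] [Fintype l]
    [DecidableEq l] {N : Matrix (k ⊕ l) (k ⊕ l) ℝ} (hN : N.PosSemidef)
    (hN₂₂ : N.toBlocks₂₂.PosDef) :
    (N.toBlocks₁₁ - N.toBlocks₁₂ * N.toBlocks₂₂⁻¹ * N.toBlocks₁₂ᵀ).PosSemidef := by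
  have := hN₂₂.isUnit.invertible
  have h₂₁ : N.toBlocks₁₂ᴴ = N.toBlocks₂₁ := by
    ext i j
    exact hN.isHermitian.apply (Sum.inr i) (Sum.inl j)
  rw [← conjTranspose_eq_transpose_of_trivial, ← Matrix.PosDef.fromBlocks₂₂ _ _ hN₂₂, h₂₁,
    fromBlocks_toBlocks]
  exact hN

theorem Matrix.PosDef.toBlocks₂₂ {k l : Type*} {N : Matrix (k ⊕ l) (k ⊕ l) ℝ}
    (hN : N.PosDef) : N.toBlocks₂₂.PosDef :=
  hN.submatrix Sum.inr_injective

section BlockPositivity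

variable {r mr nr : ℕ} {Cm : Matrix (Fin r ⊕ Fin mr) (Fin r ⊕ Fin nr) ℝ}
  {Qm : Matrix (Fin r ⊕ Fin mr) (Fin r ⊕ Fin mr) ℝ}
  {Sm : Matrix (Fin r ⊕ Fin nr) (Fin r ⊕ Fin nr) ℝ} {ε : ℝ}

theorem blkW_posDef (hQ : Qm.PosDef) (hS : Sm.PosSemidef) (hε : 0 < ε) :
    (blkW Cm Qm Sm ε).PosDef :=
  ((PosDef.one.smul hε).add_posSemidef (hS.submatrix Sum.inr)).add_posSemidef
    (hQ.toBlocks₂₂.inv.posSemidef.conjTranspose_mul_mul_same Cm.toBlocks₂₂)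

theorem blkQ_posSemidef (hQ : Qm.PosDef) (hS : Sm.PosSemidef) (hε : 0 < ε) :
    (blkQ Cm Qm Sm ε).PosSemidef := by
  let K : Matrix (Fin mr) (Fin r ⊕ Fin nr) ℝ := Cm.submatrix Sum.inr id
  let N := ε • (1 : Matrix (Fin r ⊕ Fin nr) (Fin r ⊕ Fin nr) ℝ) + Sm +
    Kᵀ * Qm.toBlocks₂₂⁻¹ * K
  have hN : N.PosSemidef :=
    ((PosSemidef.one.smul hε.le).add hS).add
      (hQ.toBlocks₂₂.inv.posSemidef.conjTranspose_mul_mul_same K)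
  have h₁₁ : N.toBlocks₁₁ = ε • 1 + Sm.toBlocks₁₁ +
      Cm.toBlocks₂₁ᵀ * Qm.toBlocks₂₂⁻¹ * Cm.toBlocks₂₁ := by
    ext i j
    simp [N, K, toBlocks₁₁, toBlocks₂₁, mul_apply, one_apply]
  have h₁₂ : N.toBlocks₁₂ = blkA Cm Qm Sm := by
    ext i j
    simp [N, K, blkA, toBlocks₁₂, toBlocks₂₁, toBlocks₂₂, mul_apply, add_comm]
  have h₂₂ : N.toBlocks₂₂ = blkW Cm Qm Sm ε := by
    ext i j
    simp [N, K, blkW, toBlocks₂₂, mul_apply, one_apply]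
  have h := hN.schurComplement₂₂ (h₂₂ ▸ blkW_posDef hQ hS hε)
  rw [h₁₁, h₁₂, h₂₂] at h
  convert h.smul (one_div_pos.mpr hε).le using 1
  rw [blkQ, smul_sub, add_assoc (ε • 1), smul_add _ (ε • 1), smul_smul,
    one_div_mul_cancel hε.ne', one_smul]
  abel

theorem blkS_posSemidef (hQ : Qm.PosDef) (hS : Sm.PosSemidef) (hε : 0 < ε) :
    (blkS Cm Qm Sm ε).PosSemidef :=
  ((hQ.posSemidef.schurComplement₂₂ hQ.toBlocks₂₂).add
    ((blkW_posDef hQ hS hε).inv.posSemidef.conjTranspose_mul_mul_same (blkB Cm Qm))).smul hε.le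

end BlockPositivity

/-- matrix positivity claims in the proof of Corollary 1.
For `Q(t)` positive definite and `H'RH` the observation quadratic form (with `R(t)`
positive definite), the matrices `Q(t,ε)` and `S(t,ε)` of the suboptimal estimator are
symmetric positive semidefinite for every `t ∈ [t0,T]` and every `ε > 0`. -/
theorem blkQ_blkS_posSemidef {r mr nr q : ℕ} (hr : 0 < r)
    (t0 T : ℝ) (hT : t0 < T)
    (C : ℝ → Matrix (Fin r ⊕ Fin mr) (Fin r ⊕ Fin nr) ℝ)
    (hC : ContinuousOn C (Icc t0 T))
    (H : ℝ → Matrix (Fin q) (Fin r ⊕ Fin nr) ℝ) (hH : ContinuousOn H (Icc t0 T))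
    (Q : ℝ → Matrix (Fin r ⊕ Fin mr) (Fin r ⊕ Fin mr) ℝ)
    (hQ : ContinuousOn Q (Icc t0 T)) (hQpd : ∀ t ∈ Icc t0 T, (Q t).PosDef)
    (R : ℝ → Matrix (Fin q) (Fin q) ℝ)
    (hR : ContinuousOn R (Icc t0 T)) (hRpd : ∀ t ∈ Icc t0 T, (R t).PosDef) :
    ∀ t ∈ Icc t0 T, ∀ ε : ℝ, 0 < ε →
      (blkQ (C t) (Q t) ((H t)ᵀ * R t * H t) ε).PosSemidef ∧
      (blkS (C t) (Q t) ((H t)ᵀ * R t * H t) ε).PosSemidef := by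
  intro t ht ε hε
  have hS : ((H t)ᵀ * R t * H t).PosSemidef :=
    (hRpd t ht).posSemidef.conjTranspose_mul_mul_same (H t)
  exact ⟨blkQ_posSemidef (hQpd t ht) hS hε, blkS_posSemidef (hQpd t ht) hS hε⟩
end
end

section
/- Let t0 < T, r ∈ ℕ, and let C, Q, S : [t0,T] → ℝ^{r×r} be continuous with Q(t) and S(t) symmetric positive semidefinite for every t. Then the matrix Riccati initial value problem K'(t) = −K(t)C(t) − C'(t)K(t) − K(t)Q(t)K(t) + S(t), K(t0) = 0, has a unique solution K defined on all of [t0,T], and K(t) is symmetric positive semidefinite for every t ∈ [t0,T]. (Unique global solvability of the Riccati equation (eq:xKz), claimed in the proof of Corollary 1.) -/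
open Matrix Set

noncomputable section

attribute [local instance] Matrix.normedAddCommGroup Matrix.normedSpace

/-- `K` is a (continuously differentiable) solution on `[t0,T]` of the matrix Riccati
initial value problem `K' = −KC − C'K − KQK + S`, `K(t0) = 0`. -/
def IsRiccatiSol (t0 T : ℝ) {r : ℕ} (C Q S : ℝ → Matrix (Fin r) (Fin r) ℝ)
    (K : ℝ → Matrix (Fin r) (Fin r) ℝ) : Prop :=
  K t0 = 0 ∧
    ∀ t ∈ Icc t0 T,
      HasDerivWithinAt K (-(K t * C t) - (C t)ᵀ * K t - K t * Q t * K t + S t)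
        (Icc t0 T) t

/-- A differentiable function on `[a, b]` with `‖f'‖ ≤ M ‖f‖` and `f a = 0` vanishes. -/
theorem eq_zero_of_norm_deriv_le_of_left {E : Type*} [NormedAddCommGroup E] [NormedSpace ℝ E]
    {f f' : ℝ → E} {M a b : ℝ}
    (hf : ∀ t ∈ Icc a b, HasDerivWithinAt f (f' t) (Icc a b) t)
    (hM : ∀ t ∈ Icc a b, ‖f' t‖ ≤ M * ‖f t‖) (ha : f a = 0) :
    ∀ t ∈ Icc a b, f t = 0 := by
  refine eq_zero_of_abs_deriv_le_mul_abs_self_of_eq_zero_right (f' := f') (K := M)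
    (fun t ht => (hf t ht).continuousWithinAt) (fun t ht => ?_) ha
    (fun t ht => hM t (Ico_subset_Icc_self ht))
  exact (hf t (Ico_subset_Icc_self ht)).mono_of_mem_nhdsWithin (Icc_mem_nhdsGE_of_mem ht)

/-- A differentiable function on `[a, b]` with `‖f'‖ ≤ M ‖f‖` and `f b = 0` vanishes. -/
theorem eq_zero_of_norm_deriv_le_of_right {E : Type*} [NormedAddCommGroup E] [NormedSpace ℝ E]
    {f f' : ℝ → E} {M a b : ℝ}
    (hf : ∀ t ∈ Icc a b, HasDerivWithinAt f (f' t) (Icc a b) t)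
    (hM : ∀ t ∈ Icc a b, ‖f' t‖ ≤ M * ‖f t‖) (hb : f b = 0) :
    ∀ t ∈ Icc a b, f t = 0 := by
  have hmaps : MapsTo (fun s => a + b - s) (Icc a b) (Icc a b) := fun s hs =>
    ⟨by linarith [hs.2], by linarith [hs.1]⟩
  have key := eq_zero_of_norm_deriv_le_of_left (f := fun s => f (a + b - s))
    (f' := fun s => (-1 : ℝ) • f' (a + b - s)) (M := M) (a := a) (b := b)
    (fun s hs => (hf _ (hmaps hs)).scomp s
      (((hasDerivAt_id s).const_sub (a + b)).hasDerivWithinAt) hmaps)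
    (fun s hs => by simpa using hM _ (hmaps hs)) (by simpa using hb)
  intro t ht
  simpa using key (a + b - t) (hmaps ht)

namespace Matrix

variable {l m n : Type*} [Fintype n]

theorem hasDerivWithinAt_iff_apply {A : ℝ → Matrix m n ℝ} {A' : Matrix m n ℝ} {s : Set ℝ}
    {t : ℝ} : HasDerivWithinAt A A' s t ↔
      ∀ i j, HasDerivWithinAt (fun τ => A τ i j) (A' i j) s t := by
  have h₁ : HasDerivWithinAt A A' s t ↔ ∀ i, HasDerivWithinAt (fun τ => A τ i) (A' i) s t :=
    hasDerivWithinAt_pi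
  rw [h₁]
  exact forall_congr' fun i => hasDerivWithinAt_pi

variable [Fintype m]

/-- The entrywise sup norm is submultiplicative up to the inner dimension. -/
theorem norm_mul_le_card_mul [Fintype l] (A : Matrix l m ℝ) (B : Matrix m n ℝ) :
    ‖A * B‖ ≤ Fintype.card m * ‖A‖ * ‖B‖ := by
  rw [norm_le_iff (by positivity)]
  intro i k
  rw [mul_apply]
  calc ‖∑ j, A i j * B j k‖ ≤ ∑ j, ‖A i j * B j k‖ := norm_sum_le _ _
    _ ≤ ∑ _j : m, ‖A‖ * ‖B‖ := by
        refine Finset.sum_le_sum fun j _ => ?_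
        rw [norm_mul]
        gcongr <;> exact norm_entry_le_entrywise_sup_norm _
    _ = Fintype.card m * ‖A‖ * ‖B‖ := by simp [mul_assoc]

theorem hasDerivWithinAt_mul {A : ℝ → Matrix l m ℝ} {B : ℝ → Matrix m n ℝ}
    {A' : Matrix l m ℝ} {B' : Matrix m n ℝ} {s : Set ℝ} {t : ℝ}
    (hA : HasDerivWithinAt A A' s t) (hB : HasDerivWithinAt B B' s t) :
    HasDerivWithinAt (fun τ => A τ * B τ) (A' * B t + A t * B') s t := by
  rw [hasDerivWithinAt_iff_apply] at hA hB ⊢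
  intro i k
  simp only [mul_apply, add_apply, ← Finset.sum_add_distrib]
  exact HasDerivWithinAt.fun_sum fun j _ => (hA i j).fun_mul (hB j k)

theorem hasDerivWithinAt_transpose {A : ℝ → Matrix m n ℝ} {A' : Matrix m n ℝ} {s : Set ℝ}
    {t : ℝ} (hA : HasDerivWithinAt A A' s t) :
    HasDerivWithinAt (fun τ => (A τ)ᵀ) A'ᵀ s t := by
  rw [hasDerivWithinAt_iff_apply] at hA ⊢
  exact fun i j => hA j i

theorem hasDerivWithinAt_inv [DecidableEq n] {A : ℝ → Matrix n n ℝ} {A' : Matrix n n ℝ}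
    {s : Set ℝ} {t : ℝ} (hA : HasDerivWithinAt A A' s t) (hdet : ∀ τ ∈ s, (A τ).det ≠ 0)
    (ht : t ∈ s) :
    HasDerivWithinAt (fun τ => (A τ)⁻¹) (-((A t)⁻¹ * A' * (A t)⁻¹)) s t := by
  have hcont : ContinuousWithinAt (fun τ => (A τ)⁻¹) s t := by
    refine ContinuousAt.comp_continuousWithinAt (g := Inv.inv) ?_ hA.continuousWithinAt
    apply continuousAt_matrix_inv
    rw [Ring.inverse_eq_inv']
    exact continuousAt_inv₀ (hdet t ht)
  refine hasDerivWithinAt_iff_tendsto_slope.2 ?_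
  replace hA := hasDerivWithinAt_iff_tendsto_slope.1 hA
  have hlim := (((hcont.mono sdiff_subset).tendsto.mul hA).mul
    (tendsto_const_nhds (x := (A t)⁻¹))).neg
  refine hlim.congr' ?_
  filter_upwards [self_mem_nhdsWithin] with τ hτ
  have h₁ : (A τ)⁻¹ * A τ = 1 := nonsing_inv_mul _ (hdet τ hτ.1).isUnit
  have h₂ : A t * (A t)⁻¹ = 1 := mul_nonsing_inv _ (hdet t ht).isUnit
  rw [slope_def_module, slope_def_module, Matrix.mul_smul, Matrix.smul_mul, ← smul_neg]
  congr 1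
  rw [Matrix.mul_sub, Matrix.sub_mul, h₁, Matrix.mul_assoc _ (A t), h₂]
  simp

/-- A solution of `W' = H W` that vanishes at the left end point vanishes. -/
theorem eq_zero_of_hasDerivWithinAt_mul_of_left {a b : ℝ} {H : ℝ → Matrix m m ℝ}
    {W : ℝ → Matrix m n ℝ} (hH : ContinuousOn H (Icc a b))
    (hW : ∀ t ∈ Icc a b, HasDerivWithinAt W (H t * W t) (Icc a b) t) (ha : W a = 0) :
    ∀ t ∈ Icc a b, W t = 0 := by
  obtain ⟨M, hM⟩ := isCompact_Icc.exists_bound_of_continuousOn hH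
  refine eq_zero_of_norm_deriv_le_of_left (M := Fintype.card m * M) hW (fun t ht => ?_) ha
  refine (norm_mul_le_card_mul _ _).trans ?_
  gcongr
  exact hM t ht

/-- A solution of `W' = H W` that vanishes at the right end point vanishes. -/
theorem eq_zero_of_hasDerivWithinAt_mul_of_right {a b : ℝ} {H : ℝ → Matrix m m ℝ}
    {W : ℝ → Matrix m n ℝ} (hH : ContinuousOn H (Icc a b))
    (hW : ∀ t ∈ Icc a b, HasDerivWithinAt W (H t * W t) (Icc a b) t) (hb : W b = 0) :
    ∀ t ∈ Icc a b, W t = 0 := by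
  obtain ⟨M, hM⟩ := isCompact_Icc.exists_bound_of_continuousOn hH
  refine eq_zero_of_norm_deriv_le_of_right (M := Fintype.card m * M) hW (fun t ht => ?_) hb
  refine (norm_mul_le_card_mul _ _).trans ?_
  gcongr
  exact hM t ht

/-- Entrywise truncation of a matrix to the interval `[-R, R]`. -/
def truncate (R : ℝ) (A : Matrix m n ℝ) : Matrix m n ℝ := A.map fun x => max (-R) (min R x)

theorem norm_truncate_le {R : ℝ} (hR : 0 ≤ R) (A : Matrix m n ℝ) : ‖truncate R A‖ ≤ R := by
  rw [norm_le_iff hR]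
  intro i j
  rw [truncate, map_apply, Real.norm_eq_abs, abs_le]
  exact ⟨le_max_left _ _, max_le (by linarith) (min_le_left _ _)⟩

theorem norm_truncate_le_norm {R : ℝ} (hR : 0 ≤ R) (A : Matrix m n ℝ) :
    ‖truncate R A‖ ≤ ‖A‖ := by
  rw [norm_le_iff (norm_nonneg _)]
  intro i j
  refine le_trans ?_ (norm_entry_le_entrywise_sup_norm A (i := i) (j := j))
  rw [truncate, map_apply, Real.norm_eq_abs, Real.norm_eq_abs, abs_le]
  constructor
  · rcases le_total R (A i j) with h | h
    · exact le_max_of_le_right (by rw [min_eq_left h]; linarith [abs_nonneg (A i j)])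
    · exact le_max_of_le_right (by rw [min_eq_right h]; exact neg_abs_le _)
  · exact max_le (by linarith [abs_nonneg (A i j)]) ((min_le_right _ _).trans (le_abs_self _))

theorem norm_truncate_sub_truncate_le (R : ℝ) (A B : Matrix m n ℝ) :
    ‖truncate R A - truncate R B‖ ≤ ‖A - B‖ := by
  rw [norm_le_iff (norm_nonneg _)]
  intro i j
  refine le_trans ?_ (norm_entry_le_entrywise_sup_norm (A - B) (i := i) (j := j))
  have h := ((LipschitzWith.id.const_min R).const_max (-R)).dist_le_mul (A i j) (B i j)
  simpa [truncate, Real.dist_eq] using h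

theorem truncate_eq_self {R : ℝ} {A : Matrix m n ℝ} (hA : ‖A‖ ≤ R) : truncate R A = A := by
  ext i j
  have h := abs_le.1 ((norm_entry_le_entrywise_sup_norm A (i := i) (j := j)).trans hA)
  rw [truncate, map_apply, min_eq_right h.2, max_eq_right h.1]

/-- Global solvability of a linear matrix differential equation with continuous coefficients. -/
theorem exists_hasDerivWithinAt_mul {a b : ℝ} (hab : a ≤ b) {H : ℝ → Matrix m m ℝ}
    (hH : ContinuousOn H (Icc a b)) (W₀ : Matrix m n ℝ) :
    ∃ W : ℝ → Matrix m n ℝ, W a = W₀ ∧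
      ∀ t ∈ Icc a b, HasDerivWithinAt W (H t * W t) (Icc a b) t := by
  obtain ⟨M₀, hM₀⟩ := isCompact_Icc.exists_bound_of_continuousOn hH
  have hM₀nn : 0 ≤ M₀ := (norm_nonneg _).trans (hM₀ a ⟨le_rfl, hab⟩)
  set M : ℝ := Fintype.card m * M₀ with hMdef
  have hM : 0 ≤ M := by positivity
  have hmul : ∀ t ∈ Icc a b, ∀ B : Matrix m n ℝ, ‖H t * B‖ ≤ M * ‖B‖ := fun t ht B => by
    refine (norm_mul_le_card_mul _ _).trans ?_
    rw [hMdef]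
    gcongr
    exact hM₀ t ht
  set R : ℝ := ‖W₀‖ * Real.exp (M * (b - a)) with hRdef
  have hR : 0 ≤ R := by positivity
  have hba : 0 ≤ b - a := sub_nonneg.2 hab
  have hPL : IsPicardLindelof (fun t B => H t * truncate R B) (⟨a, le_rfl, hab⟩ : Icc a b) W₀
      ⟨M * R * (b - a), by positivity⟩ 0 ⟨M * R, by positivity⟩ ⟨M, hM⟩ := by
    refine ⟨fun t ht => ?_, fun B _ => ?_, fun t ht B _ => ?_, ?_⟩
    · refine LipschitzOnWith.of_dist_le_mul fun A _ B _ => ?_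
      rw [dist_eq_norm, dist_eq_norm, ← Matrix.mul_sub]
      exact (hmul t ht _).trans
        (mul_le_mul_of_nonneg_left (norm_truncate_sub_truncate_le R A B) hM)
    · exact (continuous_id.matrix_mul continuous_const).comp_continuousOn hH
    · exact (hmul t ht _).trans (mul_le_mul_of_nonneg_left (norm_truncate_le hR B) hM)
    · rw [NNReal.coe_zero, sub_zero, sub_self, max_eq_left hba]
      exact le_rfl
  obtain ⟨W, hW₀, hW⟩ := hPL.exists_eq_forall_mem_Icc_hasDerivWithinAt₀
  have hbound : ∀ t ∈ Icc a b, ‖W t‖ ≤ R := fun t ht => by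
    have h := norm_le_gronwallBound_of_norm_deriv_right_le (f := W)
      (f' := fun t => H t * truncate R (W t)) (δ := ‖W₀‖) (K := M) (ε := 0)
      (fun t ht => (hW t ht).continuousWithinAt)
      (fun t ht => (hW t (Ico_subset_Icc_self ht)).mono_of_mem_nhdsWithin
        (Icc_mem_nhdsGE_of_mem ht))
      (le_of_eq (congrArg norm hW₀))
      (fun t ht => by
        rw [add_zero]
        exact (hmul t (Ico_subset_Icc_self ht) _).trans
          (mul_le_mul_of_nonneg_left (norm_truncate_le_norm hR _) hM)) t ht
    refine h.trans ?_
    rw [gronwallBound_ε0, hRdef]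
    gcongr
    exact ht.2
  refine ⟨W, hW₀, fun t ht => ?_⟩
  have h := hW t ht
  simp only [truncate_eq_self (hbound t ht)] at h
  exact h

/-- The derivative of a quadratic form along a differentiable matrix function. -/
theorem hasDerivWithinAt_dotProduct_mulVec {G : ℝ → Matrix n n ℝ} {G' : Matrix n n ℝ}
    {s : Set ℝ} {t : ℝ} (hG : HasDerivWithinAt G G' s t) (v : n → ℝ) :
    HasDerivWithinAt (fun τ => v ⬝ᵥ G τ *ᵥ v) (v ⬝ᵥ G' *ᵥ v) s t := by
  rw [hasDerivWithinAt_iff_apply] at hG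
  simp only [dotProduct, mulVec]
  exact HasDerivWithinAt.fun_sum fun i _ => HasDerivWithinAt.const_mul _
    (HasDerivWithinAt.fun_sum fun j _ => (hG i j).mul_const _)

/-- A matrix function with positive semidefinite derivative has monotone quadratic forms. -/
theorem monotoneOn_dotProduct_mulVec {a b : ℝ} {G P : ℝ → Matrix n n ℝ}
    (hG : ∀ t ∈ Icc a b, HasDerivWithinAt G (P t) (Icc a b) t)
    (hP : ∀ t ∈ Icc a b, (P t).PosSemidef) (v : n → ℝ) :
    MonotoneOn (fun t => v ⬝ᵥ G t *ᵥ v) (Icc a b) := by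
  refine monotoneOn_of_hasDerivWithinAt_nonneg (f' := fun t => v ⬝ᵥ P t *ᵥ v) (convex_Icc a b)
    (fun t ht => (hasDerivWithinAt_dotProduct_mulVec (hG t ht) v).continuousWithinAt)
    (fun t ht => ?_) (fun t ht => ?_)
  · exact (hasDerivWithinAt_dotProduct_mulVec (hG t (interior_subset ht)) v).mono interior_subset
  · simpa using (hP t (interior_subset ht)).dotProduct_mulVec_nonneg v

/-- A matrix function with positive semidefinite derivative and zero initial value is positive
semidefinite. -/
theorem posSemidef_of_hasDerivWithinAt {a b : ℝ} {G P : ℝ → Matrix n n ℝ}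
    (hG : ∀ t ∈ Icc a b, HasDerivWithinAt G (P t) (Icc a b) t)
    (hP : ∀ t ∈ Icc a b, (P t).PosSemidef) (ha : G a = 0) :
    ∀ t ∈ Icc a b, (G t).PosSemidef := by
  have hsymm := eq_zero_of_norm_deriv_le_of_left (f := fun t => (G t)ᵀ - G t)
    (f' := fun _ => 0) (M := 0) (a := a) (b := b)
    (fun t ht => by
      have h := (hasDerivWithinAt_transpose (hG t ht)).sub (hG t ht)
      have hPt : (P t)ᵀ = P t := by simpa [IsHermitian] using (hP t ht).isHermitian
      rw [hPt, sub_self] at h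
      exact h)
    (by simp) (by simp [ha])
  intro t ht
  refine PosSemidef.of_dotProduct_mulVec_nonneg ?_ fun v => ?_
  · simpa [IsHermitian, sub_eq_zero] using hsymm t ht
  · simpa [ha] using monotoneOn_dotProduct_mulVec hG hP v ⟨le_rfl, ht.1.trans ht.2⟩ ht ht.1

variable {t0 T : ℝ} {C Q S X Y : ℝ → Matrix n n ℝ}

/-- Solvability of the Hamiltonian system associated with the Riccati equation. -/
theorem exists_hamiltonian_solution [DecidableEq n] (hT : t0 ≤ T)
    (hC : ContinuousOn C (Icc t0 T)) (hQ : ContinuousOn Q (Icc t0 T))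
    (hS : ContinuousOn S (Icc t0 T)) :
    ∃ X Y : ℝ → Matrix n n ℝ, X t0 = 1 ∧ Y t0 = 0 ∧
      (∀ t ∈ Icc t0 T, HasDerivWithinAt X (C t * X t + Q t * Y t) (Icc t0 T) t) ∧
      ∀ t ∈ Icc t0 T, HasDerivWithinAt Y (S t * X t - (C t)ᵀ * Y t) (Icc t0 T) t := by
  have hH : ContinuousOn (fun t => fromBlocks (C t) (Q t) (S t) (-(C t)ᵀ)) (Icc t0 T) := by
    rw [continuousOn_iff_continuous_domRestrict] at hC hQ hS ⊢
    exact hC.matrix_fromBlocks hQ hS hC.matrix_transpose.neg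
  obtain ⟨W, hW₀, hW⟩ := exists_hasDerivWithinAt_mul hT hH (fromRows (1 : Matrix n n ℝ) 0)
  have hmul : ∀ t, fromBlocks (C t) (Q t) (S t) (-(C t)ᵀ) * W t =
      fromRows (C t * (W t).toRows₁ + Q t * (W t).toRows₂)
        (S t * (W t).toRows₁ - (C t)ᵀ * (W t).toRows₂) := fun t => by
    conv_lhs => rw [← fromRows_toRows (W t), fromBlocks_mul_fromRows]
    rw [Matrix.neg_mul, ← sub_eq_add_neg]
  refine ⟨fun t => (W t).toRows₁, fun t => (W t).toRows₂, by simp [hW₀], by simp [hW₀],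
    fun t ht => ?_, fun t ht => ?_⟩ <;>
  · have h := hW t ht
    rw [hmul, hasDerivWithinAt_iff_apply] at h
    rw [hasDerivWithinAt_iff_apply]
    intro i j
    first
      | exact h (Sum.inl i) j
      | exact h (Sum.inr i) j

/-- Along the Hamiltonian system, `Xᵀ Y` has a positive semidefinite derivative. -/
theorem hasDerivWithinAt_transpose_mul_of_hamiltonian
    (hX : ∀ t ∈ Icc t0 T, HasDerivWithinAt X (C t * X t + Q t * Y t) (Icc t0 T) t)
    (hY : ∀ t ∈ Icc t0 T, HasDerivWithinAt Y (S t * X t - (C t)ᵀ * Y t) (Icc t0 T) t)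
    (hQ : ∀ t ∈ Icc t0 T, (Q t).PosSemidef) :
    ∀ t ∈ Icc t0 T, HasDerivWithinAt (fun t => (X t)ᵀ * Y t)
      ((Y t)ᵀ * Q t * Y t + (X t)ᵀ * S t * X t) (Icc t0 T) t := by
  intro t ht
  have hQt : (Q t)ᵀ = Q t := by simpa [IsHermitian] using (hQ t ht).isHermitian
  have h := hasDerivWithinAt_mul (hasDerivWithinAt_transpose (hX t ht)) (hY t ht)
  convert h using 1
  rw [transpose_add, transpose_mul, transpose_mul, hQt]
  noncomm_ring

/-- The first block of the Hamiltonian system stays invertible. -/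
theorem det_ne_zero_of_hamiltonian [DecidableEq n] (hC : ContinuousOn C (Icc t0 T))
    (hX : ∀ t ∈ Icc t0 T, HasDerivWithinAt X (C t * X t + Q t * Y t) (Icc t0 T) t)
    (hY : ∀ t ∈ Icc t0 T, HasDerivWithinAt Y (S t * X t - (C t)ᵀ * Y t) (Icc t0 T) t)
    (hQ : ∀ t ∈ Icc t0 T, (Q t).PosSemidef) (hS : ∀ t ∈ Icc t0 T, (S t).PosSemidef)
    (hX₀ : X t0 = 1) (hY₀ : Y t0 = 0) :
    ∀ t ∈ Icc t0 T, (X t).det ≠ 0 := by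
  intro τ hτ hdet
  obtain ⟨v, hv, hXv⟩ := exists_mulVec_eq_zero_iff.2 hdet
  have hlt : t0 < τ := by
    refine lt_of_le_of_ne hτ.1 ?_
    rintro rfl
    exact hv (by simpa [hX₀] using hXv)
  have hG := hasDerivWithinAt_transpose_mul_of_hamiltonian hX hY hQ
  have hQY : ∀ t ∈ Icc t0 T, ((Y t)ᵀ * Q t * Y t).PosSemidef := fun t ht => by
    simpa using (hQ t ht).conjTranspose_mul_mul_same (Y t)
  have hSX : ∀ t ∈ Icc t0 T, ((X t)ᵀ * S t * X t).PosSemidef := fun t ht => by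
    simpa using (hS t ht).conjTranspose_mul_mul_same (X t)
  have hmono := monotoneOn_dotProduct_mulVec hG (fun t ht => (hQY t ht).add (hSX t ht)) v
  have hsub : Icc t0 τ ⊆ Icc t0 T := Icc_subset_Icc_right hτ.2
  have hzero : ∀ t ∈ Icc t0 τ, v ⬝ᵥ ((X t)ᵀ * Y t) *ᵥ v = 0 := fun t ht => by
    have h₀ := hmono (hsub ⟨le_rfl, hlt.le⟩) (hsub ht) ht.1
    have h₁ := hmono (hsub ht) hτ ht.2
    have h₂ : v ⬝ᵥ ((X τ)ᵀ * Y τ) *ᵥ v = 0 := by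
      rw [← mulVec_mulVec, dotProduct_mulVec, vecMul_transpose, hXv, zero_dotProduct]
    have h₃ : v ⬝ᵥ ((X t0)ᵀ * Y t0) *ᵥ v = 0 := by simp [hY₀]
    simp only [h₂, h₃] at h₀ h₁
    exact le_antisymm h₁ h₀
  have hQYv : ∀ t ∈ Icc t0 τ, (Q t * Y t) *ᵥ v = 0 := fun t ht => by
    have hderiv : v ⬝ᵥ ((Y t)ᵀ * Q t * Y t + (X t)ᵀ * S t * X t) *ᵥ v = 0 :=
      (uniqueDiffOn_Icc hlt t ht).eq_deriv _
        ((hasDerivWithinAt_dotProduct_mulVec (hG t (hsub ht)) v).mono hsub)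
        ((hasDerivWithinAt_const t (Icc t0 τ) (0 : ℝ)).congr hzero (hzero t ht))
    have hQnn := (hQY t (hsub ht)).dotProduct_mulVec_nonneg v
    have hSnn := (hSX t (hsub ht)).dotProduct_mulVec_nonneg v
    rw [star_trivial] at hQnn hSnn
    rw [add_mulVec, dotProduct_add] at hderiv
    have hform : v ⬝ᵥ ((Y t)ᵀ * Q t * Y t) *ᵥ v = 0 := by linarith
    rw [← mulVec_mulVec]
    refine ((hQ t (hsub ht)).dotProduct_mulVec_zero_iff _).1 ?_
    rw [star_trivial, ← hform, Matrix.mul_assoc, ← mulVec_mulVec, ← mulVec_mulVec,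
      dotProduct_mulVec v, vecMul_transpose]
  have hcol : ∀ t ∈ Icc t0 τ, X t * replicateCol Unit v = 0 :=
    eq_zero_of_hasDerivWithinAt_mul_of_right (H := C) (hC.mono hsub)
      (fun t ht => by
        have h := (hasDerivWithinAt_mul (hX t (hsub ht))
          (hasDerivWithinAt_const t _ (replicateCol Unit v))).mono hsub
        have hv₀ : Q t * Y t * replicateCol Unit v = 0 := by
          rw [← replicateCol_mulVec, hQYv t ht, replicateCol_zero]
        rwa [Matrix.add_mul, hv₀, Matrix.mul_zero, add_zero, add_zero, Matrix.mul_assoc] at h)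
      (by rw [← replicateCol_mulVec, hXv, replicateCol_zero])
  have h₀ := hcol t0 ⟨le_rfl, hlt.le⟩
  rw [hX₀, Matrix.one_mul] at h₀
  exact hv (funext fun i => congrFun (congrFun h₀ i) ())

end Matrix

/-- unique global solvability of the Riccati equation (eq:xKz).
If `C, Q, S` are continuous on `[t0,T]` with `Q(t)`, `S(t)` symmetric positive
semidefinite, then the Riccati problem `K' = −KC − C'K − KQK + S`, `K(t0) = 0` has a
unique solution on all of `[t0,T]`, and `K(t)` is symmetric positive semidefinite. -/
theorem riccati_global_existsUnique (t0 T : ℝ) (hT : t0 < T) (r : ℕ)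
    (C Q S : ℝ → Matrix (Fin r) (Fin r) ℝ)
    (hC : ContinuousOn C (Icc t0 T)) (hQ : ContinuousOn Q (Icc t0 T))
    (hS : ContinuousOn S (Icc t0 T))
    (hQpsd : ∀ t ∈ Icc t0 T, (Q t).PosSemidef)
    (hSpsd : ∀ t ∈ Icc t0 T, (S t).PosSemidef) :
    ∃ K : ℝ → Matrix (Fin r) (Fin r) ℝ,
      IsRiccatiSol t0 T C Q S K ∧
      (∀ t ∈ Icc t0 T, (K t).PosSemidef) ∧
      ∀ K' : ℝ → Matrix (Fin r) (Fin r) ℝ,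
        IsRiccatiSol t0 T C Q S K' → ∀ t ∈ Icc t0 T, K' t = K t := by
  obtain ⟨X, Y, hX₀, hY₀, hX, hY⟩ := exists_hamiltonian_solution hT.le hC hQ hS
  have hdet := det_ne_zero_of_hamiltonian hC hX hY hQpsd hSpsd hX₀ hY₀
  have hinv : ∀ t ∈ Icc t0 T, X t * (X t)⁻¹ = 1 := fun t ht =>
    mul_nonsing_inv _ (hdet t ht).isUnit
  refine ⟨fun t => Y t * (X t)⁻¹, ⟨by simp [hY₀], fun t ht => ?_⟩, fun t ht => ?_,
    fun K' hK' t ht => ?_⟩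
  · have h := hasDerivWithinAt_mul (hY t ht) (hasDerivWithinAt_inv (hX t ht) hdet ht)
    convert h using 1
    have hS₁ : S t * X t * (X t)⁻¹ = S t := by rw [Matrix.mul_assoc, hinv t ht, Matrix.mul_one]
    have hC₁ : C t * X t * (X t)⁻¹ = C t := by rw [Matrix.mul_assoc, hinv t ht, Matrix.mul_one]
    rw [Matrix.sub_mul, hS₁, Matrix.mul_assoc (X t)⁻¹, Matrix.add_mul, hC₁]
    noncomm_ring
  · have hpsd := posSemidef_of_hasDerivWithinAt
      (hasDerivWithinAt_transpose_mul_of_hamiltonian hX hY hQpsd)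
      (fun t ht => by
        simpa using ((hQpsd t ht).conjTranspose_mul_mul_same (Y t)).add
          ((hSpsd t ht).conjTranspose_mul_mul_same (X t)))
      (by simp [hY₀]) t ht
    have h := hpsd.conjTranspose_mul_mul_same (X t)⁻¹
    rwa [conjTranspose_eq_transpose_of_trivial, ← Matrix.mul_assoc, ← transpose_mul, hinv t ht,
      transpose_one, Matrix.one_mul] at h
  · have hcont : ContinuousOn K' (Icc t0 T) := fun t ht => (hK'.2 t ht).continuousWithinAt
    have hH : ContinuousOn (fun t => -((C t)ᵀ + K' t * Q t)) (Icc t0 T) := by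
      rw [continuousOn_iff_continuous_domRestrict] at hC hQ hcont ⊢
      exact (hC.matrix_transpose.add (hcont.matrix_mul hQ)).neg
    have hZ := eq_zero_of_hasDerivWithinAt_mul_of_left (W := fun t => Y t - K' t * X t) hH
      (fun t ht => by
        refine ((hY t ht).fun_sub
          (hasDerivWithinAt_mul (hK'.2 t ht) (hX t ht))).congr_deriv ?_
        noncomm_ring)
      (by simp [hY₀, hK'.1]) t ht
    change K' t = Y t * (X t)⁻¹
    rw [sub_eq_zero.1 hZ, Matrix.mul_assoc, hinv t ht, Matrix.mul_one]
end
end
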